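/- arXiv:2103.08683 — 2 statements merged into one kernel-verified Lean document; each statement's English description precedes it below -/
import Mathlib

section
/- Let n ≥ 1, d ≥ 1, and 0 < ε ≤ 1/11. If G is a d-regular ε-spectral expander on 2n vertices, then the number of perfect matchings of G satisfies m(n) ≥ (d/e)^n · (ε/(2e³d⁶))^{εn}. -/
open Matrix Finset

/-- The normalized adjacency matrix `Ã = A / d` of a (`d`-regular) graph. -/
noncomputable def normAdj {N : ℕ} (G : SimpleGraph (Fin N)) [DecidableRel G.Adj] (d : ℕ) :
    Matrix (Fin N) (Fin N) ℝ :=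
  (d : ℝ)⁻¹ • (SimpleGraph.adjMatrix ℝ G)

/-- `σ₂(Ã) = max(λ₂, |λ_N|)`, expressed via the Rayleigh quotient characterization:
for a `d`-regular graph the all-ones vector is a top eigenvector (with eigenvalue `λ₁ = 1`),
so `max(λ₂, |λ_N|)` is the supremum of `|xᵀ Ã x|` over unit vectors `x` orthogonal to
the all-ones vector. -/
noncomputable def sigma2 {N : ℕ} (G : SimpleGraph (Fin N)) [DecidableRel G.Adj] (d : ℕ) : ℝ :=
  sSup {r : ℝ | ∃ x : Fin N → ℝ, x ⬝ᵥ x = 1 ∧ (∑ i, x i) = 0 ∧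
    r = |x ⬝ᵥ (normAdj G d).mulVec x|}

/-- A matching in `G`: a set of edges of `G` that are pairwise disjoint. -/
def IsMatchingSet {N : ℕ} (G : SimpleGraph (Fin N)) (M : Finset (Sym2 (Fin N))) : Prop :=
  (↑M : Set (Sym2 (Fin N))) ⊆ G.edgeSet ∧
    ∀ e ∈ M, ∀ f ∈ M, e ≠ f → ∀ v : Fin N, v ∈ e → v ∉ f

/-- `m(k)`: the number of `k`-matchings of `G`. -/
noncomputable def numMatchings {N : ℕ} (G : SimpleGraph (Fin N)) (k : ℕ) : ℕ :=
  Nat.card {M : Finset (Sym2 (Fin N)) // IsMatchingSet G M ∧ M.card = k}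


section Spectral

set_option linter.unusedSectionVars false

variable {V : Type*} [Fintype V] [DecidableEq V]

/-- The indicator vector of a finset, with values in `ℝ`. -/
def indVec (S : Finset V) : V → ℝ := fun i => if i ∈ S then 1 else 0

lemma sum_indVec (S : Finset V) : ∑ i, indVec S i = S.card := by
  simp [indVec]

lemma indVec_dotProduct_self (S : Finset V) : indVec S ⬝ᵥ indVec S = S.card := by
  simp [indVec, dotProduct]

/-- The indicator vector projected orthogonally to the constants. -/
noncomputable def balancedVec (S : Finset V) : V → ℝ :=
  indVec S - ((S.card : ℝ) / Fintype.card V) • (1 : V → ℝ)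

lemma sum_balancedVec (S : Finset V) (hV : 0 < Fintype.card V) :
    ∑ i, balancedVec S i = 0 := by
  have : (Fintype.card V : ℝ) ≠ 0 := by positivity
  simp only [balancedVec, Pi.sub_apply, Finset.sum_sub_distrib, sum_indVec]
  simp
  field_simp
  simp

lemma balancedVec_dotProduct_self (S : Finset V) (hV : 0 < Fintype.card V) :
    balancedVec S ⬝ᵥ balancedVec S =
      S.card * (Fintype.card V - S.card) / Fintype.card V := by
  have : (Fintype.card V : ℝ) ≠ 0 := by positivity
  simp only [balancedVec, dotProduct_sub, sub_dotProduct, dotProduct_smul, smul_dotProduct,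
    dotProduct_one, one_dotProduct, sum_indVec, indVec_dotProduct_self]
  simp [sum_indVec]
  field_simp
  ring

variable (G : SimpleGraph V) [DecidableRel G.Adj]

lemma one_dotProduct_adjMatrix_mulVec {d : ℕ} (hreg : G.IsRegularOfDegree d) (y : V → ℝ) :
    (1 : V → ℝ) ⬝ᵥ (G.adjMatrix ℝ *ᵥ y) = d * ∑ i, y i := by
  rw [dotProduct_mulVec, ← mulVec_transpose, SimpleGraph.transpose_adjMatrix]
  have : G.adjMatrix ℝ *ᵥ (1 : V → ℝ) = fun _ => (d : ℝ) := by
    ext v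
    have := SimpleGraph.adjMatrix_mulVec_const_apply_of_regular (α := ℝ) (a := 1) hreg (v := v)
    simpa [Function.const] using this
  rw [this]
  simp [dotProduct, Finset.mul_sum]

lemma adjMatrix_dotProduct_comm (x y : V → ℝ) :
    x ⬝ᵥ (G.adjMatrix ℝ *ᵥ y) = y ⬝ᵥ (G.adjMatrix ℝ *ᵥ x) := by
  rw [dotProduct_mulVec, ← mulVec_transpose, SimpleGraph.transpose_adjMatrix, dotProduct_comm]

lemma balancedVec_adjMatrix {d : ℕ} (hreg : G.IsRegularOfDegree d) (S T : Finset V)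
    (hV : 0 < Fintype.card V) :
    balancedVec S ⬝ᵥ (G.adjMatrix ℝ *ᵥ balancedVec T) =
      indVec S ⬝ᵥ (G.adjMatrix ℝ *ᵥ indVec T) - d * S.card * T.card / Fintype.card V := by
  have : (Fintype.card V : ℝ) ≠ 0 := by positivity
  have h1 : indVec S ⬝ᵥ (G.adjMatrix ℝ *ᵥ (1 : V → ℝ)) = d * S.card := by
    rw [adjMatrix_dotProduct_comm, one_dotProduct_adjMatrix_mulVec G hreg, sum_indVec]
  simp only [balancedVec, mulVec_sub, mulVec_smul, dotProduct_sub, sub_dotProduct,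
    dotProduct_smul, smul_dotProduct, h1, one_dotProduct_adjMatrix_mulVec G hreg, sum_indVec]
  simp
  field_simp
  ring

lemma indVec_adjMatrix (S T : Finset V) :
    indVec S ⬝ᵥ (G.adjMatrix ℝ *ᵥ indVec T) =
      ((∑ x ∈ S, (T.filter (fun y => G.Adj x y)).card : ℕ) : ℝ) := by
  simp [indVec, dotProduct, mulVec, SimpleGraph.adjMatrix_apply, Finset.sum_ite_mem]

/-- `G` has quadratic form bounded by `ε * d` on vectors orthogonal to the constants. -/
def QuadBound (ε : ℝ) (d : ℕ) : Prop :=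
  ∀ x : V → ℝ, ∑ i, x i = 0 → |x ⬝ᵥ (G.adjMatrix ℝ *ᵥ x)| ≤ ε * d * (x ⬝ᵥ x)

variable {G}

/-- Two vertex sets with no edge between them cannot both be large. -/
lemma QuadBound.card_mul_card_le {ε : ℝ} {d : ℕ} (hQ : QuadBound G ε d)
    (hreg : G.IsRegularOfDegree d) (hd : 1 ≤ d) (S T : Finset V)
    (h : ∀ x ∈ S, ∀ y ∈ T, ¬ G.Adj x y) :
    (S.card : ℝ) * T.card ≤
      ε ^ 2 * ((Fintype.card V - S.card) * (Fintype.card V - T.card)) := by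
  have hSV : (S.card : ℝ) ≤ Fintype.card V := by exact_mod_cast S.card_le_univ
  have hTV : (T.card : ℝ) ≤ Fintype.card V := by exact_mod_cast T.card_le_univ
  have hnn : 0 ≤ ε ^ 2 * (((Fintype.card V : ℝ) - S.card) * (Fintype.card V - T.card)) :=
    mul_nonneg (sq_nonneg _) (mul_nonneg (by linarith) (by linarith))
  rcases S.card.eq_zero_or_pos with hS | hS
  · simpa [hS] using hnn
  rcases T.card.eq_zero_or_pos with hT | hT
  · simpa [hT] using hnn
  have hV : 0 < Fintype.card V := lt_of_lt_of_le hS S.card_le_univ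
  have hb := balancedVec_adjMatrix G hreg S T hV
  have h0 : indVec S ⬝ᵥ (G.adjMatrix ℝ *ᵥ indVec T) = 0 := by
    rw [indVec_adjMatrix]
    norm_cast
    refine Finset.sum_eq_zero fun x hx => ?_
    rw [Finset.card_eq_zero, Finset.filter_eq_empty_iff]
    exact fun y hy => h x hx y hy
  rw [h0, zero_sub] at hb
  set x := balancedVec S with hx
  set y := balancedVec T with hy
  have hsx : ∑ i, x i = 0 := sum_balancedVec S hV
  have hsy : ∑ i, y i = 0 := sum_balancedVec T hV
  have hxx := balancedVec_dotProduct_self S hV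
  have hyy := balancedVec_dotProduct_self T hV
  rw [← hx] at hxx
  rw [← hy] at hyy
  have key : ∀ c : ℝ, 0 ≤ (ε * d * (y ⬝ᵥ y)) * (c * c)
      + 2 * (x ⬝ᵥ (G.adjMatrix ℝ *ᵥ y)) * c + ε * d * (x ⬝ᵥ x) := by
    intro c
    have h1 := hQ (x + c • y) (by simp [Finset.sum_add_distrib, ← Finset.mul_sum, hsx, hsy])
    have h2 := hQ (x - c • y) (by simp [Finset.sum_sub_distrib, ← Finset.mul_sum, hsx, hsy])
    have h1' := (abs_le.1 h1).1
    have h2' := (abs_le.1 h2).2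
    simp only [mulVec_add, mulVec_sub, mulVec_smul, dotProduct_add, dotProduct_sub,
      add_dotProduct, sub_dotProduct, dotProduct_smul, smul_dotProduct, smul_eq_mul,
      adjMatrix_dotProduct_comm G y x, dotProduct_comm y x] at h1' h2'
    nlinarith
  have hdisc := discrim_le_zero key
  rw [discrim, hb, hxx, hyy] at hdisc
  have hN : (0 : ℝ) < Fintype.card V := by exact_mod_cast hV
  have hs : (0 : ℝ) < S.card := by exact_mod_cast hS
  have ht : (0 : ℝ) < T.card := by exact_mod_cast hT
  have hd' : (0 : ℝ) < d := by exact_mod_cast hd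
  set N : ℝ := (Fintype.card V : ℝ)
  set s : ℝ := (S.card : ℝ)
  set t : ℝ := (T.card : ℝ)
  have e : (2 * -(d * s * t / N)) ^ 2 - 4 * (ε * d * (t * (N - t) / N)) *
      (ε * d * (s * (N - s) / N)) =
      (4 * d ^ 2 * s * t / N ^ 2) * (s * t - ε ^ 2 * ((N - s) * (N - t))) := by
    field_simp
    ring
  rw [e] at hdisc
  have hpos : 0 < 4 * (d : ℝ) ^ 2 * s * t / N ^ 2 := by positivity
  by_contra hcon
  push Not at hcon
  nlinarith [mul_pos hpos (sub_pos.2 hcon)]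

/-- Lower bound for the number of (ordered) edges inside a vertex set. -/
lemma QuadBound.le_sum_card_adj {ε : ℝ} {d : ℕ} (hQ : QuadBound G ε d) (hε : 0 ≤ ε)
    (hreg : G.IsRegularOfDegree d) (S : Finset V) :
    (d : ℝ) * S.card * (S.card / Fintype.card V - ε) ≤
      ((∑ x ∈ S, (S.filter (fun y => G.Adj x y)).card : ℕ) : ℝ) := by
  rcases (Fintype.card V).eq_zero_or_pos with hV | hV
  · have : S.card = 0 := by
      have := S.card_le_univ
      lia
    rw [this]
    simp only [Nat.cast_zero, mul_zero, zero_mul]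
    positivity
  have h := (abs_le.1 (hQ _ (sum_balancedVec S hV))).1
  rw [balancedVec_adjMatrix G hreg S S hV, balancedVec_dotProduct_self S hV,
    indVec_adjMatrix] at h
  have hN : (0 : ℝ) < Fintype.card V := by exact_mod_cast hV
  set N : ℝ := (Fintype.card V : ℝ)
  set s : ℝ := (S.card : ℝ) with hs
  have hs0 : 0 ≤ s := by positivity
  have e1 : d * s * s / N = d * s * (s / N) := by ring
  have e2 : s * (N - s) / N ≤ s := by
    rw [div_le_iff₀ hN]
    nlinarith
  have e3 : ε * d * (s * (N - s) / N) ≤ ε * d * s := by gcongr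
  rw [e1] at h
  nlinarith

/-- In a graph with an edge, the spectral bound is at least `1 / d`. -/
lemma QuadBound.one_le_mul {ε : ℝ} {d : ℕ} (hQ : QuadBound G ε d) {u v : V} (h : G.Adj u v) :
    1 ≤ ε * d := by
  have hne : u ≠ v := h.ne
  have := hQ (Pi.single u 1 - Pi.single v 1) (by simp)
  simp [mulVec_sub, hne, hne.symm, h, h.symm] at this
  have h2 := (abs_le.1 this).1
  linarith

end Spectral

lemma quadBound_of_sigma2_le {N d : ℕ} (G : SimpleGraph (Fin N)) [DecidableRel G.Adj]
    (hd : 1 ≤ d) {ε : ℝ} (h : sigma2 G d ≤ ε) : QuadBound G ε d := by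
  have hd' : (0 : ℝ) < d := by exact_mod_cast hd
  intro x hx
  have hnn : 0 ≤ x ⬝ᵥ x := Finset.sum_nonneg fun i _ => mul_self_nonneg _
  rcases hnn.eq_or_lt with h0 | hpos
  · have : x = 0 := dotProduct_self_eq_zero.1 h0.symm
    simp [this]
  set r := Real.sqrt (x ⬝ᵥ x) with hr
  have hrpos : 0 < r := Real.sqrt_pos.2 hpos
  have hr2 : r * r = x ⬝ᵥ x := Real.mul_self_sqrt hnn
  have hbdd : BddAbove {r : ℝ | ∃ x : Fin N → ℝ, x ⬝ᵥ x = 1 ∧ (∑ i, x i) = 0 ∧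
      r = |x ⬝ᵥ (normAdj G d).mulVec x|} := by
    refine ⟨∑ i, ∑ j, |normAdj G d i j|, ?_⟩
    rintro _ ⟨y, hy1, -, rfl⟩
    have hy : ∀ i, |y i| ≤ 1 := by
      intro i
      rw [← sq_le_one_iff_abs_le_one, ← hy1, sq]
      exact Finset.single_le_sum (f := fun i => y i * y i) (fun j _ => mul_self_nonneg (y j))
        (Finset.mem_univ i)
    simp only [dotProduct, mulVec, Finset.mul_sum]
    refine (Finset.abs_sum_le_sum_abs _ _).trans (Finset.sum_le_sum fun i _ => ?_)
    refine (Finset.abs_sum_le_sum_abs _ _).trans (Finset.sum_le_sum fun j _ => ?_)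
    rw [abs_mul, abs_mul]
    have h1 := hy i
    have h2 := hy j
    have : |normAdj G d i j| * |y j| ≤ |normAdj G d i j| :=
      mul_le_of_le_one_right (abs_nonneg _) h2
    nlinarith [abs_nonneg (y i), abs_nonneg (y j), abs_nonneg (normAdj G d i j),
      mul_nonneg (abs_nonneg (normAdj G d i j)) (abs_nonneg (y j))]
  have hmem := le_csSup hbdd (a := |(r⁻¹ • x) ⬝ᵥ (normAdj G d).mulVec (r⁻¹ • x)|)
    ⟨r⁻¹ • x, by
      simp only [dotProduct_smul, smul_dotProduct, smul_eq_mul, ← hr2]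
      field_simp, by simp [← Finset.mul_sum, hx], rfl⟩
  have h1 := hmem.trans h
  simp only [normAdj, mulVec_smul, smul_mulVec, dotProduct_smul, smul_dotProduct, smul_eq_mul,
    abs_mul, abs_inv, Nat.abs_cast, abs_of_pos hrpos] at h1
  rw [← hr2]
  field_simp at h1
  linarith

section Pairings

set_option linter.unusedSectionVars false

variable {V : Type*}

/-- A matching of `G`, encoded as the involution exchanging matched vertices and fixing the
unmatched ones. -/
structure IsPairing (G : SimpleGraph V) (μ : V → V) : Prop where
  invol : ∀ v, μ (μ v) = v
  adj : ∀ v, μ v ≠ v → G.Adj v (μ v)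

variable [DecidableEq V]

/-- Conjugate an involution by the transposition of `x` and `w`. -/
def conjSwap (μ : V → V) (x w : V) : V → V :=
  fun z => Equiv.swap x w (μ (Equiv.swap x w z))

lemma conjSwap_conjSwap (μ : V → V) (x w : V) : conjSwap (conjSwap μ x w) w x = μ := by
  ext z
  simp [conjSwap, Equiv.swap_comm w x]

lemma conjSwap_apply {μ : V → V} {x v w : V} (hμ : ∀ z, μ (μ z) = z) (hx : μ x = x)
    (hv : μ v = w) (hvw : w ≠ v) (z : V) :
    conjSwap μ x w z = if z = x then v else if z = v then x else if z = w then w else μ z := by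
  have hw : μ w = v := by rw [← hv, hμ]
  have hxv : x ≠ v := by rintro rfl; exact hvw (hv.symm.trans hx)
  have hxw : x ≠ w := by rintro rfl; exact hvw (hx.symm.trans hw)
  unfold conjSwap
  by_cases h1 : z = x
  · subst h1
    simp [hw, Equiv.swap_apply_of_ne_of_ne hxv.symm hvw.symm]
  by_cases h2 : z = v
  · subst h2
    simp [h1, Equiv.swap_apply_of_ne_of_ne hxv.symm hvw.symm, hv]
  by_cases h3 : z = w
  · subst h3
    simp [h1, h2, hx]
  · rw [Equiv.swap_apply_of_ne_of_ne h1 h3, Equiv.swap_apply_of_ne_of_ne]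
    · simp [h1, h2, h3]
    · intro h
      exact h1 (by rw [← hμ z, h, hx])
    · intro h
      exact h2 (by rw [← hμ z, h, hw])

/-- Remove the edge at `x` from a pairing. -/
def unjoin (μ : V → V) (x : V) : V → V := fun z => if z = x ∨ z = μ x then z else μ z

/-- Add the edge `x y` to a pairing. -/
def join (μ : V → V) (x y : V) : V → V := fun z => if z = x then y else if z = y then x else μ z

lemma unjoin_join {μ : V → V} {x y : V} (hx : μ x = x) (hy : μ y = y) :
    unjoin (join μ x y) x = μ := by
  ext z
  unfold unjoin join
  grind

lemma IsPairing.join {G : SimpleGraph V} {μ : V → V} (hμ : IsPairing G μ) {x y : V}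
    (hx : μ x = x) (hy : μ y = y) (hxy : G.Adj x y) : IsPairing G (join μ x y) := by
  have := hxy.ne
  have := hxy.symm
  obtain ⟨h1, h2⟩ := hμ
  constructor <;> intro v <;> simp only [_root_.join] <;> grind

variable [Fintype V]

/-- The unmatched vertices of a pairing. -/
def holes (μ : V → V) : Finset V := Finset.univ.filter fun v => μ v = v

@[simp] lemma mem_holes {μ : V → V} {v : V} : v ∈ holes μ ↔ μ v = v := by simp [holes]

lemma holes_join {μ : V → V} {x y : V} (hxy : x ≠ y) :
    holes (join μ x y) = ((holes μ).erase x).erase y := by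
  ext v
  simp only [mem_holes, Finset.mem_erase, join]
  grind

variable (G : SimpleGraph V) [DecidableRel G.Adj]

/-- Move the hole `a.2` of the pairing `a.1` along `v` to the partner of `v`. -/
def slide (a : (V → V) × V) (v : V) : (V → V) × V := (conjSwap a.1 a.2 (a.1 v), a.1 v)

/-- The configurations reachable by at most `t` slides. -/
def slideSet : ℕ → (V → V) × V → Finset ((V → V) × V)
  | 0, a => {a}
  | t + 1, a => insert a ((G.neighborFinset a.2).biUnion fun v => slideSet t (slide a v))

lemma self_mem_slideSet (t : ℕ) (a : (V → V) × V) : a ∈ slideSet G t a := by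
  cases t <;> simp [slideSet]

lemma slideSet_subset_succ (t : ℕ) (a : (V → V) × V) :
    slideSet G t a ⊆ slideSet G (t + 1) a := by
  induction t generalizing a with
  | zero => simp [slideSet]
  | succ t ih =>
    rw [slideSet, slideSet]
    exact Finset.insert_subset_insert _ (Finset.biUnion_mono fun v _ => ih _)

lemma slideSet_mono {s t : ℕ} (h : s ≤ t) (a : (V → V) × V) :
    slideSet G s a ⊆ slideSet G t a :=
  monotone_nat_of_le_succ (f := fun t => slideSet G t a) (fun t => slideSet_subset_succ G t a) h

lemma card_slideSet_lt {d : ℕ} (hreg : G.IsRegularOfDegree d) (hd : 2 ≤ d) (t : ℕ)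
    (a : (V → V) × V) : (slideSet G t a).card < 2 * d ^ t := by
  induction t generalizing a with
  | zero => simp [slideSet]
  | succ t ih =>
    rw [slideSet]
    have h1 : ((G.neighborFinset a.2).biUnion fun v => slideSet G t (slide a v)).card ≤
        d * (2 * d ^ t - 1) := by
      rw [← hreg a.2, ← G.card_neighborFinset_eq_degree a.2]
      refine Finset.card_biUnion_le_card_mul _ _ _ fun v _ => ?_
      have := ih (slide a v)
      rw [G.card_neighborFinset_eq_degree, hreg a.2]
      lia
    have h2 := Finset.card_insert_le a
      ((G.neighborFinset a.2).biUnion fun v => slideSet G t (slide a v))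
    have h3 : 0 < d ^ t := by positivity
    obtain ⟨k, hk⟩ := Nat.exists_eq_add_of_lt h3
    have h4 : d * (2 * d ^ t - 1) + d = 2 * d ^ (t + 1) := by
      rw [show 2 * d ^ t - 1 = 2 * k + 1 by lia, pow_succ, hk]
      ring
    lia

/-- The pairings from which `μ'` arises by sliding two holes at most `t` times each and then
joining them. -/
def preSet (t : ℕ) (μ' : V → V) : Finset (V → V) :=
  Finset.univ.biUnion fun x : V =>
    (slideSet G t (unjoin μ' x, μ' x)).biUnion fun b =>
      (slideSet G t (b.1, x)).image Prod.fst

lemma card_preSet_le {d : ℕ} (hreg : G.IsRegularOfDegree d) (hd : 2 ≤ d) (t : ℕ) (μ' : V → V) :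
    (preSet G t μ').card ≤ Fintype.card V * (4 * d ^ (2 * t)) := by
  refine Finset.card_biUnion_le_card_mul _ _ _ fun x _ => ?_
  refine (Finset.card_biUnion_le_card_mul _ _ (2 * d ^ t) fun b _ => ?_).trans ?_
  · exact Finset.card_image_le.trans (card_slideSet_lt G hreg hd t _).le
  · calc _ ≤ (2 * d ^ t) * (2 * d ^ t) :=
        Nat.mul_le_mul_right _ (card_slideSet_lt G hreg hd t _).le
      _ = 4 * d ^ (2 * t) := by ring

/-- Within the vertex set `F`, the hole `u` of `μ` can be moved to `x` by at most `t` slides. -/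
structure HoleReach (μ : V → V) (F : Finset V) (t : ℕ) (u x : V) : Prop where
  hole : μ u = u
  start_mem : u ∈ F
  mem : x ∈ F
  eq_or : x = u ∨ μ x ≠ x
  move : ∀ ν, IsPairing G ν → (∀ v ∈ F, ν v = μ v) → ∃ ν', IsPairing G ν' ∧
    (∀ v ∉ F, ν' v = ν v) ∧ (∀ v, ν' v = v ↔ (ν v = v ∧ v ≠ u) ∨ v = x) ∧
    (ν, u) ∈ slideSet G t (ν', x)

variable {G}

lemma HoleReach.refl {μ : V → V} {F : Finset V} {u : V} (hu : μ u = u) (huF : u ∈ F) (t : ℕ) :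
    HoleReach G μ F t u u where
  hole := hu
  start_mem := huF
  mem := huF
  eq_or := Or.inl rfl
  move ν hν hF := ⟨ν, hν, fun _ _ => rfl, fun v => by grind, self_mem_slideSet G _ _⟩

lemma HoleReach.mono {μ : V → V} {F F' : Finset V} {s t : ℕ} {u x : V}
    (h : HoleReach G μ F s u x) (hF : F ⊆ F') (hst : s ≤ t) : HoleReach G μ F' t u x where
  hole := h.hole
  start_mem := hF h.start_mem
  mem := hF h.mem
  eq_or := h.eq_or
  move ν hν hνF := by
    obtain ⟨ν', h1, h2, h3, h4⟩ := h.move ν hν fun v hv => hνF v (hF hv)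
    exact ⟨ν', h1, fun v hv => h2 v fun hv' => hv (hF hv'), h3, slideSet_mono G hst _ h4⟩

lemma HoleReach.step {μ : V → V} (hμ : IsPairing G μ) {F F' : Finset V} {t : ℕ} {u x v : V}
    (h : HoleReach G μ F t u x) (hF : F ⊆ F') (hv : v ∉ F) (hw : μ v ∉ F) (hv' : v ∈ F')
    (hw' : μ v ∈ F') (hne : μ v ≠ v) (hadj : G.Adj x v) :
    HoleReach G μ F' (t + 1) u (μ v) where
  hole := h.hole
  start_mem := hF h.start_mem
  mem := hw'
  eq_or := Or.inr (by rw [hμ.invol]; exact hne.symm)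
  move ν hν hνF := by
    obtain ⟨ν', h1, h2, h3, h4⟩ := h.move ν hν fun v hv => hνF v (hF hv)
    have hx : ν' x = x := (h3 x).2 (Or.inr rfl)
    have hνv : ν' v = μ v := by rw [h2 v hv, hνF v hv']
    have hνw : ν' (μ v) = v := by rw [h2 _ hw, hνF _ hw', hμ.invol]
    have happ := conjSwap_apply h1.invol hx hνv hne
    have hxF := h.mem
    refine ⟨conjSwap ν' x (μ v), ?_, ?_, ?_, ?_⟩
    · constructor
      · intro z
        have := h1.invol (Equiv.swap x (μ v) z)
        simp [conjSwap, this]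
      · intro z hz
        have h5 := h1.adj z
        have h6 := hadj.symm
        rw [happ] at hz ⊢
        grind
    · intro z hz
      rw [happ]
      have := h2 z
      grind
    · intro z
      have h5 := h3 z
      have h6 := h3 v
      rw [happ]
      have h7 : ν v = μ v := hνF v hv'
      have h8 : ν (μ v) = v := by rw [hνF _ hw', hμ.invol]
      have := h.hole
      have := h.eq_or
      grind
    · rw [slideSet]
      refine Finset.mem_insert_of_mem (Finset.mem_biUnion.2 ⟨v, ?_, ?_⟩)
      · have := h1.adj (μ v) (by rw [hνw]; exact hne.symm)
        simpa [hνw] using this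
      · have e : conjSwap ν' x (μ v) v = x := by
          rw [happ]
          have : v ≠ x := hadj.ne'
          simp [this]
        simp only [slide, e, conjSwap_conjSwap]
        exact h4

/-- Joining two holes moved inside disjoint vertex sets to adjacent positions. -/
lemma HoleReach.exists_join {μ : V → V} (hμ : IsPairing G μ) {F₁ F₂ : Finset V} {t : ℕ}
    {u₁ u₂ x₁ x₂ : V} (h₁ : HoleReach G μ F₁ t u₁ x₁) (h₂ : HoleReach G μ F₂ t u₂ x₂)
    (hdisj : Disjoint F₁ F₂) (hadj : G.Adj x₁ x₂) :
    ∃ μ', IsPairing G μ' ∧ holes μ' = ((holes μ).erase u₁).erase u₂ ∧ μ ∈ preSet G t μ' := by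
  have hu : u₁ ≠ u₂ := fun h => Finset.disjoint_left.1 hdisj h₁.start_mem (h ▸ h₂.start_mem)
  obtain ⟨μ₁, p₁, a₁, b₁, c₁⟩ := h₁.move μ hμ fun _ _ => rfl
  obtain ⟨μ₂, p₂, a₂, b₂, c₂⟩ := h₂.move μ₁ p₁ fun v hv =>
    a₁ v (Finset.disjoint_right.1 hdisj hv)
  have e₁ := h₁.eq_or
  have e₂ := h₂.eq_or
  have f₁ := h₁.hole
  have f₂ := h₂.hole
  have hne := hadj.ne
  have hx₂ : μ₂ x₂ = x₂ := (b₂ _).2 (Or.inr rfl)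
  have hx₁ : μ₂ x₁ = x₁ := by
    rw [a₂ x₁ (Finset.disjoint_left.1 hdisj h₁.mem)]
    exact (b₁ _).2 (Or.inr rfl)
  refine ⟨join μ₂ x₁ x₂, p₂.join hx₁ hx₂ hadj, ?_, ?_⟩
  · rw [holes_join hne]
    ext v
    have := b₁ v
    have := b₂ v
    have := b₂ x₁
    simp only [Finset.mem_erase, mem_holes]
    grind
  · refine Finset.mem_biUnion.2 ⟨x₁, Finset.mem_univ _, Finset.mem_biUnion.2 ⟨(μ₁, u₂), ?_,
      Finset.mem_image.2 ⟨(μ, u₁), c₁, rfl⟩⟩⟩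
    rw [unjoin_join hx₁ hx₂]
    simpa [join] using c₂

variable (G) in
/-- Some pairing with two holes fewer, among them `u`, arises from `μ` by sliding two holes at
most `t` times each and joining them. -/
def AugmentsAt (t : ℕ) (μ : V → V) (u : V) : Prop :=
  ∃ μ', IsPairing G μ' ∧ u ∉ holes μ' ∧ holes μ' ⊆ holes μ ∧
    (holes μ').card + 2 = (holes μ).card ∧ μ ∈ preSet G t μ'

lemma HoleReach.augmentsAt {μ : V → V} (hμ : IsPairing G μ) {F₁ F₂ : Finset V} {t : ℕ}
    {u₁ u₂ x₁ x₂ : V} (h₁ : HoleReach G μ F₁ t u₁ x₁) (h₂ : HoleReach G μ F₂ t u₂ x₂)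
    (hdisj : Disjoint F₁ F₂) (hadj : G.Adj x₁ x₂) : AugmentsAt G t μ u₁ := by
  have hu : u₁ ≠ u₂ := fun h => Finset.disjoint_left.1 hdisj h₁.start_mem (h ▸ h₂.start_mem)
  obtain ⟨μ', p, e, m⟩ := h₁.exists_join hμ h₂ hdisj hadj
  refine ⟨μ', p, by simp [e], ?_, ?_, m⟩
  · rw [e]
    exact (Finset.erase_subset _ _).trans (Finset.erase_subset _ _)
  · have hm₁ : u₁ ∈ holes μ := by simpa using h₁.hole
    have hm₂ : u₂ ∈ (holes μ).erase u₁ := by simpa using ⟨hu.symm, h₂.hole⟩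
    rw [e, ← Finset.card_erase_add_one hm₁, ← Finset.card_erase_add_one hm₂]

variable (G) in
/-- An alternating forest on the vertex set `F` with outer vertices `S`, rooted in `B`, of depth
at most `t`. -/
structure AltForest (μ : V → V) (B F S : Finset V) (t : ℕ) : Prop where
  closed : ∀ v ∈ F, μ v ∈ F
  card_lt : F.card < 2 * S.card
  reach : ∀ x ∈ S, ∃ u ∈ B, HoleReach G μ F t u x

/-- Enlarge one of two disjoint alternating forests by a new layer. -/
lemma AltForest.grow {ε : ℝ} {d : ℕ} (hQ : QuadBound G ε d) (hreg : G.IsRegularOfDegree d)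
    (hd : 1 ≤ d) (hε0 : 0 < ε) (hε : ε ≤ 1 / 11) {μ : V → V} (hμ : IsPairing G μ)
    {B : Finset V} {τ : ℕ} (hB : ∀ u ∈ B, ¬ AugmentsAt G τ μ u) {F₁ S₁ F₂ S₂ : Finset V}
    {t t' T : ℕ} (h₁ : AltForest G μ B F₁ S₁ t) (h₂ : AltForest G μ B F₂ S₂ t')
    (hdisj : Disjoint F₁ F₂) (hS₁ : S₁.card ≤ T) (hS₂ : S₂.card ≤ T) (hT : T ≤ 16 * S₁.card)
    (hTε : (T : ℝ) < ε * Fintype.card V + 1) (hτ : t ≤ τ) :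
    ∃ F S, AltForest G μ B F S (t + 1) ∧ S.card = T ∧ Disjoint F F₂ := by
  suffices H : ∀ k, S₁.card + k ≤ T → ∃ F S, F₁ ⊆ F ∧ AltForest G μ B F S (t + 1) ∧
      S.card = S₁.card + k ∧ Disjoint F F₂ by
    obtain ⟨F, S, -, h1, h2, h3⟩ := H (T - S₁.card) (by lia)
    exact ⟨F, S, h1, by lia, h3⟩
  intro k
  induction k with
  | zero =>
    intro _
    refine ⟨F₁, S₁, subset_rfl, ⟨h₁.closed, h₁.card_lt, fun x hx => ?_⟩, rfl, hdisj⟩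
    obtain ⟨u, hu, hr⟩ := h₁.reach x hx
    exact ⟨u, hu, hr.mono subset_rfl (Nat.le_succ t)⟩
  | succ k ih =>
    intro hk
    obtain ⟨F, S, hF, hfor, hcard, hd'⟩ := ih (by lia)
    have hfree : ∃ x ∈ S₁, ∃ v ∈ (F ∪ F₂)ᶜ, G.Adj x v := by
      by_contra hcon
      push Not at hcon
      have hmix := hQ.card_mul_card_le hreg hd S₁ (F ∪ F₂)ᶜ hcon
      have hf : (F ∪ F₂).card + 4 ≤ 4 * T := by
        have := Finset.card_union_le F F₂
        have := hfor.card_lt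
        have := h₂.card_lt
        lia
      have hs : 0 < S₁.card := by
        have := h₁.card_lt
        lia
      have hcompl : (((F ∪ F₂)ᶜ.card : ℕ) : ℝ) = Fintype.card V - (F ∪ F₂).card := by
        rw [Finset.card_compl, Nat.cast_sub (Finset.card_le_univ _)]
      rw [hcompl] at hmix
      have hf' : ((F ∪ F₂).card : ℝ) + 4 ≤ 4 * T := by exact_mod_cast hf
      have hT' : (T : ℝ) ≤ 16 * S₁.card := by exact_mod_cast hT
      have hs' : (0 : ℝ) < S₁.card := by exact_mod_cast hs
      have hN : (S₁.card : ℝ) ≤ Fintype.card V := by exact_mod_cast S₁.card_le_univ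
      set f : ℝ := ((F ∪ F₂).card : ℝ)
      set s : ℝ := (S₁.card : ℝ)
      set N : ℝ := (Fintype.card V : ℝ)
      have hf0 : 0 ≤ f := by positivity
      have hN0 : 0 < N := by linarith
      have a1 : s * f ≤ s * (4 * ε * N) := by
        apply mul_le_mul_of_nonneg_left _ hs'.le
        linarith
      have a2 : ε ^ 2 * N * f ≤ ε ^ 2 * N * (64 * s) := by
        apply mul_le_mul_of_nonneg_left _ (by positivity)
        linarith
      have a3 : 0 ≤ ε ^ 2 * s * f := by positivity
      have a4 : s * N ≤ s * N * (4 * ε + 64 * ε ^ 2) := by nlinarith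
      have a5 : 4 * ε + 64 * ε ^ 2 < 1 := by nlinarith
      have a6 : 0 < s * N := by positivity
      nlinarith
    obtain ⟨x, hx, v, hv, hadj⟩ := hfree
    obtain ⟨u, hu, hr⟩ := h₁.reach x hx
    have hv' : v ∉ F ∧ v ∉ F₂ := by simpa [not_or] using hv
    have hne : μ v ≠ v := by
      intro hvv
      refine hB u hu (HoleReach.augmentsAt hμ (hr.mono hF hτ) (F₂ := {v})
        (HoleReach.refl hvv (Finset.mem_singleton_self v) τ) ?_ hadj)
      simpa using hv'.1
    have hw : μ v ∉ F := fun h => hv'.1 (by simpa [hμ.invol] using hfor.closed _ h)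
    have hw₂ : μ v ∉ F₂ := fun h => hv'.2 (by simpa [hμ.invol] using h₂.closed _ h)
    have hsub : F ⊆ insert v (insert (μ v) F) :=
      (Finset.subset_insert _ _).trans (Finset.subset_insert _ _)
    have hwS : μ v ∉ S := fun h => by
      obtain ⟨_, _, hr⟩ := hfor.reach _ h
      exact hw hr.mem
    refine ⟨insert v (insert (μ v) F), insert (μ v) S, hF.trans hsub, ⟨?_, ?_, ?_⟩, ?_, ?_⟩
    · intro z hz
      simp only [Finset.mem_insert] at hz ⊢
      rcases hz with rfl | rfl | hz
      · simp
      · simp [hμ.invol]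
      · simp [hfor.closed z hz]
    · rw [Finset.card_insert_of_notMem hwS]
      have h1 := Finset.card_insert_le v (insert (μ v) F)
      have h2 := Finset.card_insert_le (μ v) F
      have h3 := hfor.card_lt
      lia
    · intro z hz
      rcases Finset.mem_insert.1 hz with rfl | hz
      · exact ⟨u, hu, (hr.mono hF le_rfl).step hμ hsub hv'.1 hw (by simp) (by simp) hne hadj⟩
      · obtain ⟨u', hu', hr'⟩ := hfor.reach z hz
        exact ⟨u', hu', hr'.mono hsub le_rfl⟩
    · rw [Finset.card_insert_of_notMem hwS, hcard]
      ring
    · simp [hv'.2, hw₂, hd']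

/-- At most `2 * a - 1` holes cannot be filled by a short augmentation. -/
lemma card_lt_of_forall_not_augmentsAt {ε : ℝ} {d : ℕ} (hQ : QuadBound G ε d)
    (hreg : G.IsRegularOfDegree d) (hd : 1 ≤ d) (hε0 : 0 < ε) (hε : ε ≤ 1 / 11) {μ : V → V}
    (hμ : IsPairing G μ) {B : Finset V} (hBh : B ⊆ holes μ) {τ a : ℕ} (ha : 1 ≤ a)
    (haε : a ≤ ⌈ε * Fintype.card V⌉₊) (hτ : ε * Fintype.card V ≤ 16 ^ τ * a)
    (hB : ∀ u ∈ B, ¬ AugmentsAt G τ μ u) : B.card < 2 * a := by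
  by_contra hcard
  push Not at hcard
  obtain ⟨B₁, hB₁, hc₁⟩ := Finset.exists_subset_card_eq (s := B) (n := a) (by lia)
  obtain ⟨B₂, hB₂, hc₂⟩ := Finset.exists_subset_card_eq (s := B \ B₁) (n := a) (by
    rw [Finset.card_sdiff_of_subset hB₁]
    lia)
  set K := ⌈ε * Fintype.card V⌉₊ with hK
  have hKlt : (K : ℝ) < ε * Fintype.card V + 1 := Nat.ceil_lt_add_one (by positivity)
  have hbase : ∀ B' ⊆ B, B'.card = a → AltForest G μ B B' B' 0 := by
    intro B' hB' hc
    refine ⟨fun v hv => ?_, by lia, fun x hx => ⟨x, hB' hx, ?_⟩⟩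
    · rwa [mem_holes.1 (hBh (hB' hv))]
    · exact HoleReach.refl (mem_holes.1 (hBh (hB' hx))) hx 0
  have hlevels : ∀ t ≤ τ, ∃ F₁ S₁ F₂ S₂, AltForest G μ B F₁ S₁ t ∧ AltForest G μ B F₂ S₂ t ∧
      Disjoint F₁ F₂ ∧ S₁.card = min (16 ^ t * a) K ∧ S₂.card = min (16 ^ t * a) K := by
    intro t
    induction t with
    | zero =>
      intro _
      refine ⟨B₁, B₁, B₂, B₂, hbase _ hB₁ hc₁, hbase _ (hB₂.trans Finset.sdiff_subset) hc₂,
        ?_, ?_, ?_⟩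
      · exact Finset.disjoint_left.2 fun v h1 h2 => (Finset.mem_sdiff.1 (hB₂ h2)).2 h1
      · simp [hc₁, haε]
      · simp [hc₂, haε]
    | succ t ih =>
      intro ht
      obtain ⟨F₁, S₁, F₂, S₂, f₁, f₂, hdis, hs₁, hs₂⟩ := ih (by lia)
      have hpow : 16 ^ (t + 1) * a = 16 * (16 ^ t * a) := by ring
      set T := min (16 ^ (t + 1) * a) K with hT
      have hTK : T ≤ K := min_le_right _ _
      have hTε : (T : ℝ) < ε * Fintype.card V + 1 :=
        lt_of_le_of_lt (by exact_mod_cast hTK) hKlt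
      obtain ⟨F₁', S₁', f₁', c₁', d₁'⟩ := f₁.grow hQ hreg hd hε0 hε hμ hB f₂ hdis
        (T := T) (by lia) (by lia) (by lia) hTε (by lia)
      obtain ⟨F₂', S₂', f₂', c₂', d₂'⟩ := f₂.grow hQ hreg hd hε0 hε hμ hB f₁' d₁'.symm
        (T := T) (by lia) (by lia) (by lia) hTε (by lia)
      exact ⟨F₁', S₁', F₂', S₂', f₁', f₂', d₂'.symm, c₁', c₂'⟩
  obtain ⟨F₁, S₁, F₂, S₂, f₁, f₂, hdis, hs₁, hs₂⟩ := hlevels τ le_rfl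
  have hmin : min (16 ^ τ * a) K = K := by
    refine min_eq_right (Nat.ceil_le.2 ?_)
    push_cast
    exact hτ
  rw [hmin] at hs₁ hs₂
  have hno : ∀ x ∈ S₁, ∀ y ∈ S₂, ¬ G.Adj x y := by
    intro x hx y hy hadj
    obtain ⟨u, hu, hr⟩ := f₁.reach x hx
    obtain ⟨u', -, hr'⟩ := f₂.reach y hy
    exact hB u hu (hr.augmentsAt hμ hr' hdis hadj)
  have hmix := hQ.card_mul_card_le hreg hd S₁ S₂ hno
  have hKN : (K : ℝ) ≤ Fintype.card V := by
    rw [← hs₁]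
    exact_mod_cast S₁.card_le_univ
  have hK1 : (1 : ℝ) ≤ K := by exact_mod_cast ha.trans haε
  have hK2 : ε * Fintype.card V ≤ K := Nat.le_ceil _
  rw [hs₁, hs₂] at hmix
  set N : ℝ := (Fintype.card V : ℝ)
  have h1 : 0 ≤ ε * (N - K) := mul_nonneg hε0.le (by linarith)
  have h2 : ε * (N - K) < K := by nlinarith
  nlinarith


variable (G) in
open Classical in
/-- The pairings with exactly `2 * j` holes. -/
noncomputable def pairings (j : ℕ) : Finset (V → V) :=
  Finset.univ.filter fun μ => IsPairing G μ ∧ (holes μ).card = 2 * j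

lemma mem_pairings {j : ℕ} {μ : V → V} :
    μ ∈ pairings G j ↔ IsPairing G μ ∧ (holes μ).card = 2 * j := by
  simp [pairings]

lemma id_mem_pairings {n : ℕ} (hn : Fintype.card V = 2 * n) : id ∈ pairings G n := by
  rw [mem_pairings]
  exact ⟨⟨fun _ => rfl, fun v h => absurd rfl h⟩, by simp [holes, hn]⟩

/-- Filling two of `2 * (j + 1)` holes by a short augmentation. -/
lemma mul_card_pairings_succ_le {ε : ℝ} {d : ℕ} (hQ : QuadBound G ε d)
    (hreg : G.IsRegularOfDegree d) (hd : 2 ≤ d) (hε0 : 0 < ε) (hε : ε ≤ 1 / 11) {j t : ℕ}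
    (hj : (j + 2) / 2 ≤ ⌈ε * Fintype.card V⌉₊)
    (ht : ε * Fintype.card V ≤ 16 ^ t * ((j + 2) / 2 : ℕ)) :
    (j + 1) * (pairings G (j + 1)).card ≤
      8 * Fintype.card V * d ^ (2 * t) * (pairings G j).card := by
  classical
  have key := Finset.card_mul_le_card_mul (s := pairings G (j + 1)) (t := pairings G j)
    (fun μ μ' => μ ∈ preSet G t μ') (m := (j + 2) / 2)
    (n := Fintype.card V * (4 * d ^ (2 * t))) ?_ ?_
  · have h : j + 1 ≤ 2 * ((j + 2) / 2) := by lia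
    calc (j + 1) * (pairings G (j + 1)).card
        ≤ 2 * ((j + 2) / 2) * (pairings G (j + 1)).card := Nat.mul_le_mul_right _ h
      _ = 2 * ((pairings G (j + 1)).card * ((j + 2) / 2)) := by ring
      _ ≤ 2 * ((pairings G j).card * (Fintype.card V * (4 * d ^ (2 * t)))) := by gcongr
      _ = _ := by ring
  · intro μ hμ
    obtain ⟨hμ, hcard⟩ := mem_pairings.1 hμ
    set B := (holes μ).filter fun u => ¬ AugmentsAt G t μ u with hB
    have hBc : B.card < 2 * ((j + 2) / 2) :=
      card_lt_of_forall_not_augmentsAt hQ hreg (by lia) hε0 hε hμ (Finset.filter_subset _ _)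
        (by lia) hj ht fun u hu => (Finset.mem_filter.1 hu).2
    set R := (pairings G j).bipartiteAbove (fun μ μ' => μ ∈ preSet G t μ') μ with hR
    have hsub : holes μ \ B ⊆
        (R.filter fun μ' => holes μ' ⊆ holes μ).biUnion fun μ' => holes μ \ holes μ' := by
      intro u hu
      obtain ⟨hu, huB⟩ := Finset.mem_sdiff.1 hu
      have haug : AugmentsAt G t μ u := by
        by_contra hcon
        exact huB (Finset.mem_filter.2 ⟨hu, hcon⟩)
      obtain ⟨μ', p, hu', hsub, hc, hpre⟩ := haug
      refine Finset.mem_biUnion.2 ⟨μ', Finset.mem_filter.2 ⟨?_, hsub⟩,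
        Finset.mem_sdiff.2 ⟨hu, hu'⟩⟩
      exact Finset.mem_bipartiteAbove _ |>.2 ⟨mem_pairings.2 ⟨p, by lia⟩, hpre⟩
    have h1 := (Finset.card_le_card hsub).trans
      (Finset.card_biUnion_le_card_mul _ _ 2 fun μ' hμ' => ?_)
    · have h2 : (R.filter fun μ' => holes μ' ⊆ holes μ).card ≤ R.card := Finset.card_filter_le _ _
      rw [Finset.card_sdiff_of_subset (Finset.filter_subset _ _), hcard] at h1
      lia
    · obtain ⟨hμ', hs⟩ := Finset.mem_filter.1 hμ'
      have := (mem_pairings.1 (Finset.mem_bipartiteAbove _ |>.1 hμ').1).2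
      rw [Finset.card_sdiff_of_subset hs]
      lia
  · intro μ' _
    refine (Finset.card_le_card fun μ hμ => ?_).trans (card_preSet_le G hreg hd t μ')
    exact (Finset.mem_bipartiteBelow _ |>.1 hμ).2

/-- Filling two of `2 * (j + 1)` holes by adding an edge between them. -/
lemma edges_mul_card_pairings_succ_le {ε : ℝ} {d : ℕ} (hQ : QuadBound G ε d)
    (hreg : G.IsRegularOfDegree d) (hε0 : 0 < ε) {j n : ℕ} (hn : Fintype.card V = 2 * n)
    (hn0 : 1 ≤ n) (hj : j ≤ n) :
    (d : ℝ) * (j + 1) * ((j + 1) - ε * n) * (pairings G (j + 1)).card ≤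
      n * (n - j) * (pairings G j).card := by
  classical
  set c : ℝ := d * (2 * (j + 1)) * (2 * (j + 1) / (2 * n) - ε) with hc
  have key := Finset.card_mul_le_card_mul (s := pairings G (j + 1))
    (t := (pairings G j).sigma fun μ' => (holes μ')ᶜ)
    (fun μ p => unjoin p.1 p.2 = μ) (m := ⌈c⌉₊) (n := 1) ?_ ?_
  · have h1 : ((pairings G j).sigma fun μ' => (holes μ')ᶜ).card =
        (pairings G j).card * (2 * n - 2 * j) := by
      rw [Finset.card_sigma]
      refine Finset.sum_const_nat fun μ' hμ' => ?_
      rw [Finset.card_compl, hn, (mem_pairings.1 hμ').2]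
    rw [h1, mul_one] at key
    have key' : ((pairings G (j + 1)).card : ℝ) * ⌈c⌉₊ ≤
        (pairings G j).card * (2 * n - 2 * j) := by
      have : ((2 * n - 2 * j : ℕ) : ℝ) = 2 * n - 2 * j := by
        rw [Nat.cast_sub (by lia)]
        push_cast
        ring
      rw [← this]
      exact_mod_cast key
    have h2 : c ≤ ⌈c⌉₊ := Nat.le_ceil c
    have h3 : ((pairings G (j + 1)).card : ℝ) * c ≤
        (pairings G j).card * (2 * n - 2 * j) :=
      (mul_le_mul_of_nonneg_left h2 (by positivity)).trans key'
    have hn' : (0 : ℝ) < n := by exact_mod_cast hn0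
    have h4 : n * c = 2 * (d * (j + 1) * ((j + 1) - ε * n)) := by
      rw [hc]
      field_simp
    have h5 := mul_le_mul_of_nonneg_left h3 hn'.le
    have h6 : (n : ℝ) * ((pairings G (j + 1)).card * c) =
        2 * (d * (j + 1) * ((j + 1) - ε * n)) * (pairings G (j + 1)).card := by
      rw [← h4]
      ring
    rw [h6] at h5
    linarith
  · intro μ hμ
    obtain ⟨hμ, hcard⟩ := mem_pairings.1 hμ
    have hE := hQ.le_sum_card_adj hε0.le hreg (holes μ)
    rw [hcard, hn, ← Finset.card_sigma] at hE
    push_cast at hE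
    rw [← hc] at hE
    refine (Nat.ceil_le.2 hE).trans ?_
    refine Finset.card_le_card_of_injOn (fun p => ⟨join μ p.1 p.2, p.1⟩) ?_ ?_
    · rintro ⟨x, y⟩ hp
      obtain ⟨hx, hy, hadj⟩ : μ x = x ∧ μ y = y ∧ G.Adj x y := by simpa using hp
      have hne := hadj.ne
      refine (Finset.mem_bipartiteAbove _).2 ⟨Finset.mem_sigma.2 ⟨mem_pairings.2
        ⟨hμ.join hx hy hadj, ?_⟩, ?_⟩, unjoin_join hx hy⟩
      · have hm₁ : x ∈ holes μ := by simpa using hx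
        have hm₂ : y ∈ (holes μ).erase x := by simpa using ⟨hne.symm, hy⟩
        rw [holes_join hne]
        have h1 := Finset.card_erase_add_one hm₁
        have h2 := Finset.card_erase_add_one hm₂
        lia
      · simp [holes_join hne]
    · rintro ⟨x, y⟩ hp ⟨x', y'⟩ hp' heq
      simp only [Sigma.mk.injEq, heq_eq_eq] at heq
      obtain ⟨h1, rfl⟩ := heq
      have := congrFun h1 x
      simp only [join, if_true] at this
      rw [this]
  · rintro ⟨μ', x⟩ _
    refine Finset.card_le_one.2 fun μ₁ h₁ μ₂ h₂ => ?_
    rw [Finset.mem_bipartiteBelow] at h₁ h₂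
    exact h₁.2.symm.trans h₂.2

end Pairings

lemma card_pairings_zero_le_numMatchings {n : ℕ} (G : SimpleGraph (Fin (2 * n)))
    [DecidableRel G.Adj] : (pairings G 0).card ≤ numMatchings G n := by
  classical
  have hfix : ∀ μ ∈ pairings G 0, ∀ v, μ v ≠ v := by
    intro μ hμ v hv
    have := (mem_pairings.1 hμ).2
    rw [mul_zero, Finset.card_eq_zero] at this
    have hmem : v ∈ holes μ := mem_holes.2 hv
    simp [this] at hmem
  have hM : ∀ μ ∈ pairings G 0, IsMatchingSet G (Finset.univ.image fun v => s(v, μ v)) ∧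
      (Finset.univ.image fun v => s(v, μ v)).card = n := by
    intro μ hμ
    have hp := (mem_pairings.1 hμ).1
    have hf := hfix μ hμ
    refine ⟨⟨?_, ?_⟩, ?_⟩
    · intro e he
      obtain ⟨v, -, rfl⟩ := Finset.mem_image.1 (Finset.mem_coe.1 he)
      exact hp.adj v (hf v)
    · intro e he f hef hne v hve hvf
      obtain ⟨a, -, rfl⟩ := Finset.mem_image.1 he
      obtain ⟨b, -, rfl⟩ := Finset.mem_image.1 hef
      have ha := hp.invol a
      have hb := hp.invol b
      simp only [Sym2.mem_iff] at hve hvf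
      apply hne
      rw [Sym2.eq_iff]
      grind
    · have h := Finset.card_eq_sum_card_image (fun v => s(v, μ v)) Finset.univ
      rw [Finset.sum_const_nat (m := 2)] at h
      · simp only [Finset.card_univ, Fintype.card_fin] at h
        lia
      · intro e he
        obtain ⟨v, -, rfl⟩ := Finset.mem_image.1 he
        rw [Finset.card_eq_two]
        refine ⟨v, μ v, (hf v).symm, ?_⟩
        ext w
        have h1 := hp.invol v
        have h2 := hp.invol w
        simp only [Finset.mem_filter, Finset.mem_univ, true_and, Sym2.eq_iff,
          Finset.mem_insert, Finset.mem_singleton]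
        grind
  rw [numMatchings, ← Nat.card_eq_finsetCard]
  refine Nat.card_le_card_of_injective
    (fun μ => ⟨Finset.univ.image fun v => s(v, μ.1 v), hM μ.1 μ.2⟩) ?_
  rintro ⟨μ, hμ⟩ ⟨ν, hν⟩ heq
  have himg := Subtype.ext_iff.1 heq
  simp only at himg
  ext1
  funext v
  have hmem : s(v, μ v) ∈ Finset.univ.image fun v => s(v, ν v) := by
    rw [← himg]
    exact Finset.mem_image_of_mem _ (Finset.mem_univ v)
  obtain ⟨w, -, hw⟩ := Finset.mem_image.1 hmem
  have hinv := (mem_pairings.1 hν).1.invol w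
  rw [Sym2.eq_iff] at hw
  grind

lemma sum_inv_sqrt_le (m : ℕ) :
    ∑ i ∈ Finset.range m, 1 / Real.sqrt (i + 1) ≤ 2 * Real.sqrt m := by
  induction m with
  | zero => simp
  | succ m ih =>
    rw [Finset.sum_range_succ]
    push_cast
    have h0 : (0 : ℝ) ≤ m := by positivity
    set a := Real.sqrt (m : ℝ) with ha
    set b := Real.sqrt ((m : ℝ) + 1) with hb
    have ha2 : a ^ 2 = m := Real.sq_sqrt h0
    have hb2 : b ^ 2 = m + 1 := Real.sq_sqrt (by linarith)
    have hbpos : 0 < b := Real.sqrt_pos.2 (by linarith)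
    have h1 : 1 / b ≤ 2 * (b - a) := by
      rw [div_le_iff₀ hbpos]
      nlinarith [sq_nonneg (b - a)]
    linarith

lemma exists_depth {x : ℝ} (hx : 0 < x) (j : ℕ) : ∃ t : ℕ, 4 * x ≤ 16 ^ t * (j + 1 : ℝ) ∧
    (t : ℝ) ≤ 1 + Real.sqrt x / 2 * (1 / Real.sqrt (j + 1)) ∧ (x ≤ 4 → t ≤ 1) := by
  have hj : (0 : ℝ) < (j : ℝ) + 1 := by positivity
  have hex : ∃ t : ℕ, 4 * x ≤ 16 ^ t * (j + 1 : ℝ) := by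
    obtain ⟨t, ht⟩ := pow_unbounded_of_one_lt (4 * x / (j + 1)) (by norm_num : (1 : ℝ) < 16)
    exact ⟨t, by rw [div_lt_iff₀ hj] at ht; exact ht.le⟩
  classical
  refine ⟨Nat.find hex, Nat.find_spec hex, ?_, fun h4 => Nat.find_min' hex ?_⟩
  · rcases Nat.lt_or_ge (Nat.find hex) 2 with h2 | h2
    · have : ((Nat.find hex : ℕ) : ℝ) ≤ 1 := by exact_mod_cast Nat.lt_succ_iff.1 h2
      have : 0 ≤ Real.sqrt x / 2 * (1 / Real.sqrt (j + 1)) := by positivity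
      linarith
    · obtain ⟨k, hk⟩ := Nat.exists_eq_add_of_le h2
      have hlt := Nat.find_min hex (m := k + 1) (by lia)
      push Not at hlt
      rw [hk]
      have hk4 : ((k : ℝ) + 1) ≤ 4 ^ k := by
        have : k + 1 ≤ 4 ^ k := Nat.lt_pow_self (by norm_num)
        exact_mod_cast this
      have hsq : 4 ^ k ≤ Real.sqrt (x / (4 * (j + 1))) := by
        apply Real.le_sqrt_of_sq_le
        rw [le_div_iff₀ (by positivity), ← pow_mul, mul_comm k 2, pow_mul]
        rw [pow_succ] at hlt
        norm_num
        linarith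
      have heq : Real.sqrt (x / (4 * (j + 1))) =
          Real.sqrt x / 2 * (1 / Real.sqrt (j + 1)) := by
        rw [Real.sqrt_div hx.le, Real.sqrt_mul (by norm_num),
          show (4 : ℝ) = 2 ^ 2 by norm_num, Real.sqrt_sq (by norm_num)]
        field_simp
      rw [← heq]
      push_cast
      linarith
  · have : (0 : ℝ) ≤ j := by positivity
    rw [pow_one]
    linarith

/-- The total number of slides needed to fill the last `⌈x⌉₊` pairs of holes. -/
lemma exists_depths {x : ℝ} (hx : 1 / 2 ≤ x) : ∃ t : ℕ → ℕ,
    (∀ j, 4 * x ≤ 16 ^ t j * (j + 1 : ℝ)) ∧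
    ((⌈x⌉₊ + 2 * ∑ j ∈ Finset.range ⌈x⌉₊, t j : ℕ) : ℝ) ≤ 6 * x ∧ (⌈x⌉₊ : ℝ) ≤ 2 * x := by
  have hx0 : 0 < x := by linarith
  choose t ht1 ht2 ht3 using exists_depth hx0
  set l := ⌈x⌉₊ with hl
  have hl1 : (l : ℝ) < x + 1 := Nat.ceil_lt_add_one hx0.le
  have hl2 : (l : ℝ) ≤ 2 * x := by
    rcases le_or_gt x 1 with h | h
    · have : l ≤ 1 := Nat.ceil_le.2 (by simpa using h)
      have : (l : ℝ) ≤ 1 := by exact_mod_cast this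
      linarith
    · linarith
  refine ⟨t, ht1, ?_, hl2⟩
  push_cast
  rcases le_or_gt x 4 with h | h
  · have : ∑ j ∈ Finset.range l, (t j : ℝ) ≤ ∑ j ∈ Finset.range l, (1 : ℝ) :=
      Finset.sum_le_sum fun j _ => by exact_mod_cast ht3 j h
    simp at this
    linarith
  · have h1 : ∑ j ∈ Finset.range l, (t j : ℝ) ≤ l + Real.sqrt x / 2 * (2 * Real.sqrt l) := by
      calc ∑ j ∈ Finset.range l, (t j : ℝ)
          ≤ ∑ j ∈ Finset.range l, (1 + Real.sqrt x / 2 * (1 / Real.sqrt (j + 1))) :=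
            Finset.sum_le_sum fun j _ => ht2 j
        _ = l + Real.sqrt x / 2 * ∑ j ∈ Finset.range l, 1 / Real.sqrt (j + 1) := by
            rw [Finset.sum_add_distrib, Finset.mul_sum]
            simp
        _ ≤ _ := by
            have := sum_inv_sqrt_le l
            gcongr
    have h2 : Real.sqrt x * Real.sqrt l ≤ 112 / 100 * x := by
      rw [← Real.sqrt_mul hx0.le]
      apply Real.sqrt_le_iff.2 ⟨by linarith, ?_⟩
      nlinarith
    linarith

/-- Iterating the two ways of filling holes. -/
lemma pow_mul_factorial_le_card_pairings {n d : ℕ} (hn : 1 ≤ n) (hd : 2 ≤ d) {ε : ℝ}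
    (hε0 : 0 < ε) (hε : ε ≤ 1 / 11) {G : SimpleGraph (Fin (2 * n))} [DecidableRel G.Adj]
    (hreg : G.IsRegularOfDegree d) (hQ : QuadBound G ε d) {t : ℕ → ℕ}
    (ht : ∀ j, 4 * (ε * n) ≤ 16 ^ t j * (j + 1 : ℝ)) :
    (d : ℝ) ^ (n - ⌈ε * n⌉₊) * n.factorial ≤ n ^ n * 16 ^ ⌈ε * n⌉₊ *
      d ^ (2 * ∑ j ∈ Finset.range ⌈ε * n⌉₊, t j) * (pairings G 0).card := by
  have hcard : Fintype.card (Fin (2 * n)) = 2 * n := by simp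
  have hn0 : (0 : ℝ) < n := by exact_mod_cast hn
  have hx0 : 0 < ε * n := by positivity
  set l := ⌈ε * n⌉₊ with hl
  have hln : l ≤ n := Nat.ceil_le.2 (by nlinarith)
  have hlx : ε * n ≤ l := Nat.le_ceil _
  set p : ℕ → ℝ := fun j => ((pairings G j).card : ℝ) with hp
  have hgreedy : ∀ k ≤ n - l, (d : ℝ) ^ k * n.factorial * (n - l).factorial ≤
      n ^ k * k.factorial * (n - k).factorial * (n - l - k).factorial * p (n - k) := by
    intro k
    induction k with
    | zero =>
      intro _
      have : 1 ≤ p n := by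
        have : 0 < (pairings G n).card := Finset.card_pos.2 ⟨id, id_mem_pairings hcard⟩
        simpa [hp] using this
      simp only [pow_zero, one_mul, Nat.factorial_zero, Nat.cast_one, Nat.sub_zero]
      exact le_mul_of_one_le_right (by positivity) this
    | succ k ih =>
      intro hk
      obtain ⟨j, hj⟩ : ∃ j, n - k = j + 1 := ⟨n - k - 1, by lia⟩
      obtain ⟨i, hi⟩ : ∃ i, n - l - k = i + 1 := ⟨n - l - k - 1, by lia⟩
      have hj' : n - (k + 1) = j := by lia
      have hi' : n - l - (k + 1) = i := by lia
      have hjl : j + 1 = i + 1 + l := by lia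
      have hnk : (n : ℝ) = j + 1 + k := by
        have : n = j + 1 + k := by lia
        exact_mod_cast this
      have hjl' : (j : ℝ) + 1 = i + 1 + l := by exact_mod_cast hjl
      have hstep := edges_mul_card_pairings_succ_le (G := G) hQ hreg hε0 hcard hn (j := j)
        (by lia)
      have hstep' : (d : ℝ) * (j + 1) * (i + 1) * p (j + 1) ≤ n * (k + 1) * p j := by
        have hi1 : (i : ℝ) + 1 ≤ (j + 1) - ε * n := by linarith
        have hc : (d : ℝ) * (j + 1) * (i + 1) ≤ d * (j + 1) * ((j + 1) - ε * n) :=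
          mul_le_mul_of_nonneg_left hi1 (by positivity)
        rw [show (n : ℝ) - j = k + 1 by linarith] at hstep
        exact (mul_le_mul_of_nonneg_right hc (Nat.cast_nonneg _)).trans hstep
      have hprev := ih (by lia)
      rw [hj, hi] at hprev
      rw [hj', hi']
      calc (d : ℝ) ^ (k + 1) * n.factorial * (n - l).factorial
          = d * (d ^ k * n.factorial * (n - l).factorial) := by ring
        _ ≤ d * (n ^ k * k.factorial * (j + 1).factorial * (i + 1).factorial * p (j + 1)) := by
            gcongr
        _ = n ^ k * k.factorial * j.factorial * i.factorial *
            (d * (j + 1) * (i + 1) * p (j + 1)) := by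
            push_cast [Nat.factorial_succ]
            ring
        _ ≤ n ^ k * k.factorial * j.factorial * i.factorial * (n * (k + 1) * p j) := by gcongr
        _ = _ := by
            push_cast [Nat.factorial_succ]
            ring
  have haug : ∀ j ≤ l, p j * j.factorial ≤
      (16 * n) ^ j * (d : ℝ) ^ (2 * ∑ i ∈ Finset.range j, t i) * p 0 := by
    intro j
    induction j with
    | zero => simp
    | succ j ih =>
      intro hj
      have hceil : (j + 2) / 2 ≤ ⌈ε * Fintype.card (Fin (2 * n))⌉₊ := by
        have : l ≤ ⌈ε * Fintype.card (Fin (2 * n))⌉₊ := by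
          apply Nat.ceil_mono
          rw [hcard]
          push_cast
          linarith
        lia
      have hdepth : ε * Fintype.card (Fin (2 * n)) ≤ 16 ^ t j * ((j + 2) / 2 : ℕ) := by
        have h1 : j + 1 ≤ 2 * ((j + 2) / 2) := by lia
        have h2 : (j : ℝ) + 1 ≤ 2 * ((j + 2) / 2 : ℕ) := by exact_mod_cast h1
        have h3 : (16 : ℝ) ^ t j * (j + 1) ≤ 16 ^ t j * (2 * ((j + 2) / 2 : ℕ)) := by gcongr
        have h4 := ht j
        rw [hcard]
        push_cast at h3 ⊢
        linarith
      have hstep := mul_card_pairings_succ_le (G := G) hQ hreg hd hε0 hε hceil hdepth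
      rw [hcard] at hstep
      have hstep' : ((j : ℝ) + 1) * p (j + 1) ≤ 16 * n * d ^ (2 * t j) * p j := by
        have : ((j : ℝ) + 1) * p (j + 1) ≤ 8 * (2 * n) * d ^ (2 * t j) * p j := by
          simp only [hp]
          exact_mod_cast hstep
        linarith
      calc p (j + 1) * (j + 1).factorial = ((j + 1) * p (j + 1)) * j.factorial := by
            push_cast [Nat.factorial_succ]
            ring
        _ ≤ (16 * n * d ^ (2 * t j) * p j) * j.factorial := by gcongr
        _ = 16 * n * d ^ (2 * t j) * (p j * j.factorial) := by ring
        _ ≤ 16 * n * d ^ (2 * t j) *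
            ((16 * n) ^ j * (d : ℝ) ^ (2 * ∑ i ∈ Finset.range j, t i) * p 0) := by
            have := ih (by lia)
            gcongr
        _ = _ := by
            rw [Finset.sum_range_succ, mul_add, pow_add, pow_succ]
            ring
  have h1 := hgreedy (n - l) le_rfl
  have hsub : n - (n - l) = l := by lia
  rw [hsub, Nat.sub_self, Nat.factorial_zero, Nat.cast_one, mul_one] at h1
  have h2 : (d : ℝ) ^ (n - l) * n.factorial ≤ n ^ (n - l) * (p l * l.factorial) := by
    have hpos : (0 : ℝ) < (n - l).factorial := by exact_mod_cast Nat.factorial_pos _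
    refine le_of_mul_le_mul_right ?_ hpos
    linarith
  calc (d : ℝ) ^ (n - l) * n.factorial ≤ n ^ (n - l) * (p l * l.factorial) := h2
    _ ≤ n ^ (n - l) * ((16 * n) ^ l * (d : ℝ) ^ (2 * ∑ i ∈ Finset.range l, t i) * p 0) := by
        have := haug l le_rfl
        gcongr
    _ = n ^ (n - l + l) * 16 ^ l * d ^ (2 * ∑ j ∈ Finset.range l, t j) * p 0 := by
        rw [mul_pow, pow_add]
        ring
    _ = _ := by rw [Nat.sub_add_cancel hln]

theorem lower_bound_perfect_matchings (n d : ℕ) (hn : 1 ≤ n) (hd : 1 ≤ d)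
    (ε : ℝ) (hε0 : 0 < ε) (hε : ε ≤ 1 / 11)
    (G : SimpleGraph (Fin (2 * n))) [DecidableRel G.Adj]
    (hreg : G.IsRegularOfDegree d) (hexp : sigma2 G d ≤ ε) :
    ((d : ℝ) / Real.exp 1) ^ n *
      (ε / (2 * Real.exp 1 ^ 3 * (d : ℝ) ^ 6)) ^ (ε * n) ≤ (numMatchings G n : ℝ) := by
  have hn0 : (0 : ℝ) < n := by exact_mod_cast hn
  have hd0 : (0 : ℝ) < d := by exact_mod_cast hd
  have hQ := quadBound_of_sigma2_le G hd hexp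
  let v₀ : Fin (2 * n) := ⟨0, by lia⟩
  have hεd : 1 ≤ ε * d := by
    have hpos : 0 < G.degree v₀ := by
      rw [hreg v₀]
      exact hd
    obtain ⟨w, hw⟩ := (G.degree_pos_iff_exists_adj v₀).1 hpos
    exact hQ.one_le_mul hw
  have hd11 : (11 : ℝ) ≤ d := by nlinarith
  have hd2 : 2 ≤ d := by
    have : 11 ≤ d := by exact_mod_cast hd11
    lia
  have hdn : d < 2 * n := by
    have := G.degree_lt_card_verts v₀
    rwa [hreg v₀, Fintype.card_fin] at this
  have hx : 1 / 2 ≤ ε * n := by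
    have : (d : ℝ) ≤ 2 * n := by exact_mod_cast hdn.le
    nlinarith
  obtain ⟨t, ht, hsum, hl⟩ := exists_depths hx
  have hmain := pow_mul_factorial_le_card_pairings hn hd2 hε0 hε hreg hQ ht
  have hln : ⌈ε * n⌉₊ ≤ n := Nat.ceil_le.2 (by nlinarith)
  set l := ⌈ε * n⌉₊
  set σ := ∑ j ∈ Finset.range l, t j
  have hcount : ((pairings G 0).card : ℝ) ≤ numMatchings G n := by
    exact_mod_cast card_pairings_zero_le_numMatchings G
  refine le_trans ?_ hcount
  set P : ℝ := ((pairings G 0).card : ℝ)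
  have hexp1 : ((d : ℝ) / Real.exp 1) ^ n ≤ d ^ n * (n.factorial / n ^ n) := by
    have h := Real.pow_div_factorial_le_exp (n : ℝ) hn0.le n
    rw [div_pow, ← Real.exp_nat_mul, mul_one, div_eq_mul_inv]
    have hf : (0 : ℝ) < n.factorial := by exact_mod_cast Nat.factorial_pos n
    have : (Real.exp n)⁻¹ ≤ n.factorial / n ^ n := by
      rw [← inv_div]
      exact inv_anti₀ (by positivity) h
    gcongr
  have hloss : (ε / (2 * Real.exp 1 ^ 3 * (d : ℝ) ^ 6)) ^ (ε * n) ≤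
      (16 ^ l * (d : ℝ) ^ (l + 2 * σ))⁻¹ := by
    have he : (19 : ℝ) ≤ Real.exp 1 ^ 3 := by
      have : (2.7 : ℝ) ≤ Real.exp 1 := by linarith [Real.exp_one_gt_d9]
      calc (19 : ℝ) ≤ 2.7 ^ 3 := by norm_num
        _ ≤ _ := by gcongr
    have hbase : ε / (2 * Real.exp 1 ^ 3 * (d : ℝ) ^ 6) ≤ (16 ^ 2 * (d : ℝ) ^ 6)⁻¹ := by
      rw [div_le_iff₀ (by positivity), inv_mul_eq_div, le_div_iff₀ (by positivity)]
      have : (0 : ℝ) < (d : ℝ) ^ 6 := by positivity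
      nlinarith
    calc (ε / (2 * Real.exp 1 ^ 3 * (d : ℝ) ^ 6)) ^ (ε * n)
        ≤ ((16 ^ 2 * (d : ℝ) ^ 6)⁻¹) ^ (ε * n) := by gcongr
      _ = ((16 : ℝ) ^ (2 * (ε * n)) * (d : ℝ) ^ (6 * (ε * n)))⁻¹ := by
          rw [Real.inv_rpow (by positivity), Real.mul_rpow (by positivity) (by positivity),
            ← Real.rpow_natCast, ← Real.rpow_natCast, ← Real.rpow_mul (by norm_num),
            ← Real.rpow_mul hd0.le]
          norm_num
      _ ≤ _ := by
          have h1 : (16 : ℝ) ^ l ≤ (16 : ℝ) ^ (2 * (ε * n)) := by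
            rw [← Real.rpow_natCast]
            exact Real.rpow_le_rpow_of_exponent_le (by norm_num) hl
          have h2 : (d : ℝ) ^ (l + 2 * σ) ≤ (d : ℝ) ^ (6 * (ε * n)) := by
            rw [← Real.rpow_natCast]
            exact Real.rpow_le_rpow_of_exponent_le (by linarith) hsum
          gcongr
  have hd_split : (d : ℝ) ^ n = d ^ (n - l) * d ^ l := by
    rw [← pow_add, Nat.sub_add_cancel hln]
  calc ((d : ℝ) / Real.exp 1) ^ n * (ε / (2 * Real.exp 1 ^ 3 * (d : ℝ) ^ 6)) ^ (ε * n)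
      ≤ (d ^ n * (n.factorial / n ^ n)) * (16 ^ l * (d : ℝ) ^ (l + 2 * σ))⁻¹ := by gcongr
    _ = (d ^ (n - l) * n.factorial) / (n ^ n * 16 ^ l * d ^ (2 * σ)) := by
        rw [hd_split, pow_add]
        field_simp
    _ ≤ P := by
        rw [div_le_iff₀ (by positivity)]
        linarith
end

section
/- Let 0 < ε < 1, let α ≥ 10, and let G = (V, E) be a graph on 2n vertices such that every S ⊆ V with |S| ≤ 2εn satisfies |N(S)| ≥ α|S|. Let M be a matching in G with |M| < n, and let U_L, U_R be a partition of the unsaturated vertices of M with |U_L| = |U_R|. Set t = max(⌈log_{α/4}((2εn+1)/|U_L|)⌉, 0). If G contains no augmenting path for M of length at most 4t+1 with one endpoint in U_L and the other in U_R, then with probability strictly greater than 1/2 over ω drawn from μ_M there exists a set S contained in the left side L of G_M(ω) with |S| > 2εn such that for every v ∈ S there is an alternating path for M of length at most 2t, all of whose edges lie in E_M(ω), from some vertex of U_L to v. -/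
open Matrix Finset

/-- A vertex is unsaturated for a matching `M` if it lies in no edge of `M`. -/
def Unsaturated {N : ℕ} (M : Finset (Sym2 (Fin N))) (v : Fin N) : Prop :=
  ∀ e ∈ M, v ∉ e

/-- A walk is alternating for `M` if among any two consecutive edges exactly one is in `M`. -/
def IsAlternating {N : ℕ} {G : SimpleGraph (Fin N)} (M : Finset (Sym2 (Fin N)))
    {u v : Fin N} (p : G.Walk u v) : Prop :=
  p.edges.Chain' (fun e f => Xor' (e ∈ M) (f ∈ M))

/-- An augmenting path for `M`: an alternating path both of whose endpoints are
unsaturated by `M`. -/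
def IsAugmentingPath {N : ℕ} {G : SimpleGraph (Fin N)} (M : Finset (Sym2 (Fin N)))
    {u v : Fin N} (p : G.Walk u v) : Prop :=
  p.IsPath ∧ IsAlternating M p ∧ Unsaturated M u ∧ Unsaturated M v

/-- The smaller endpoint of an edge (giving each matching edge a fixed ordering of its
endpoints). -/
def symMin {N : ℕ} (e : Sym2 (Fin N)) : Fin N :=
  Sym2.lift ⟨fun a b => min a b, fun a b => min_comm a b⟩ e

/-- The larger endpoint of an edge. -/
def symMax {N : ℕ} (e : Sym2 (Fin N)) : Fin N :=
  Sym2.lift ⟨fun a b => max a b, fun a b => max_comm a b⟩ e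

/-- The left side `L` of the bipartition `G_M(ω)`: all of `U_L`, together with, for each
matching edge `e` (with its fixed endpoint ordering `(symMin e, symMax e)`), the endpoint
`symMin e` if `ω e = 0` and the endpoint `symMax e` if `ω e = 1`.  The right side is the
complement (it consists of `U_R` and the opposite endpoints of the matching edges). -/
def leftSide {N : ℕ} (M : Finset (Sym2 (Fin N))) (UL : Finset (Fin N))
    (ω : {e : Sym2 (Fin N) // e ∈ M} → Bool) : Set (Fin N) :=
  ↑UL ∪ {v | ∃ e : {e : Sym2 (Fin N) // e ∈ M},
    (ω e = false ∧ v = symMin e.val) ∨ (ω e = true ∧ v = symMax e.val)}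

/-- An edge lies in `E_M(ω)` iff one endpoint is on the left side `L` and the other is
not (i.e. it is on the right side). -/
def CrossesLR {N : ℕ} (L : Set (Fin N)) (e : Sym2 (Fin N)) : Prop :=
  ∃ a b : Fin N, e = s(a, b) ∧ a ∈ L ∧ b ∉ L

section LeftSide

variable {N : ℕ} {G : SimpleGraph (Fin N)} {M : Finset (Sym2 (Fin N))} {UL : Finset (Fin N)}

/-- A matched vertex has only one partner. -/
theorem IsMatchingSet.partner_unique (hM : IsMatchingSet G M) {a b c : Fin N}
    (hb : s(a, b) ∈ M) (hc : s(a, c) ∈ M) : b = c := by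
  by_contra hne
  exact hM.2 _ hb _ hc (fun h => hne (Sym2.congr_right.1 h)) a (by simp) (by simp)

theorem IsMatchingSet.eq_of_mem (hM : IsMatchingSet G M) {e f : Sym2 (Fin N)} {v : Fin N}
    (he : e ∈ M) (hf : f ∈ M) (hve : v ∈ e) (hvf : v ∈ f) : e = f := by
  by_contra hne
  exact hM.2 e he f hf hne v hve hvf

theorem symMin_mem (e : Sym2 (Fin N)) : symMin e ∈ e := by
  induction e with
  | h a b => rcases le_total a b with h | h <;> simp [symMin, h]

theorem symMax_mem (e : Sym2 (Fin N)) : symMax e ∈ e := by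
  induction e with
  | h a b => rcases le_total a b with h | h <;> simp [symMax, h]

/-- A saturated vertex is on the left exactly when its matching edge is oriented that way. -/
theorem mem_leftSide_iff (hM : IsMatchingSet G M) (hUL : ∀ v ∈ UL, Unsaturated M v)
    (ω : {e : Sym2 (Fin N) // e ∈ M} → Bool) (e : {e : Sym2 (Fin N) // e ∈ M})
    {v : Fin N} (hv : v ∈ e.val) :
    v ∈ leftSide M UL ω ↔ v = if ω e then symMax e.val else symMin e.val := by
  constructor
  · rintro (h | ⟨f, hf⟩)
    · exact absurd hv (hUL v h e.val e.property)
    · have hvf : v ∈ f.val := by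
        rcases hf with ⟨-, rfl⟩ | ⟨-, rfl⟩
        · exact symMin_mem _
        · exact symMax_mem _
      obtain rfl : e = f := Subtype.ext (hM.eq_of_mem e.property f.property hv hvf)
      rcases hf with ⟨h, rfl⟩ | ⟨h, rfl⟩ <;> simp [h]
  · intro h
    refine Or.inr ⟨e, ?_⟩
    cases hω : ω e <;> simp_all

theorem mem_leftSide_congr (hM : IsMatchingSet G M) (hUL : ∀ v ∈ UL, Unsaturated M v)
    {ω ω' : {e : Sym2 (Fin N) // e ∈ M} → Bool} {e : {e : Sym2 (Fin N) // e ∈ M}}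
    (h : ω e = ω' e) {v : Fin N} (hv : v ∈ e.val) :
    v ∈ leftSide M UL ω ↔ v ∈ leftSide M UL ω' := by
  rw [mem_leftSide_iff hM hUL ω e hv, mem_leftSide_iff hM hUL ω' e hv, h]

/-- Exactly one endpoint of a matching edge is on the left. -/
theorem mem_leftSide_iff_partner_notMem (hM : IsMatchingSet G M)
    (hUL : ∀ v ∈ UL, Unsaturated M v) (ω : {e : Sym2 (Fin N) // e ∈ M} → Bool)
    {a b : Fin N} (hab : s(a, b) ∈ M) :
    a ∈ leftSide M UL ω ↔ b ∉ leftSide M UL ω := by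
  have hne : a ≠ b := G.ne_of_adj (hM.1 hab)
  rw [mem_leftSide_iff hM hUL ω ⟨_, hab⟩ (Sym2.mem_mk_left a b),
    mem_leftSide_iff hM hUL ω ⟨_, hab⟩ (Sym2.mem_mk_right a b)]
  rcases le_total a b with h | h <;> cases ω ⟨_, hab⟩ <;> simp [symMin, symMax, h, hne, hne.symm]

/-- Either endpoint of a matching edge can be sent to the right by some orientation. -/
theorem exists_orientation_notMem_leftSide (hM : IsMatchingSet G M)
    (hUL : ∀ v ∈ UL, Unsaturated M v) {a b : Fin N} (hab : s(a, b) ∈ M) :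
    ∃ c : Bool, ∀ ω : {e : Sym2 (Fin N) // e ∈ M} → Bool, ω ⟨_, hab⟩ = c →
      a ∉ leftSide M UL ω := by
  by_cases h : a ∈ leftSide M UL (fun _ => true)
  · refine ⟨false, fun ω hω => ?_⟩
    have hne : a ≠ b := G.ne_of_adj (hM.1 hab)
    rw [mem_leftSide_iff hM hUL _ ⟨_, hab⟩ (Sym2.mem_mk_left a b)] at h ⊢
    rw [hω]
    rcases le_total a b with h' | h' <;> simp_all [symMin, symMax]
  · exact ⟨true, fun ω hω => (mem_leftSide_congr hM hUL
      (ω' := fun _ => true) hω (Sym2.mem_mk_left a b)).not.mpr h⟩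

theorem exists_partner_of_mem_leftSide {ω : {e : Sym2 (Fin N) // e ∈ M} → Bool} {v : Fin N}
    (hv : v ∈ leftSide M UL ω) : v ∈ UL ∨ ∃ w, s(v, w) ∈ M := by
  rcases hv with h | ⟨e, he⟩
  · exact Or.inl h
  · have hve : v ∈ e.val := by
      rcases he with ⟨-, rfl⟩ | ⟨-, rfl⟩
      · exact symMin_mem _
      · exact symMax_mem _
    obtain ⟨w, hw⟩ := hve
    exact Or.inr ⟨w, hw ▸ e.property⟩

end LeftSide

section Reach

variable {N : ℕ} {G : SimpleGraph (Fin N)} {M : Finset (Sym2 (Fin N))} {UL : Finset (Fin N)}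

open Classical in
/-- The left vertices whose partner is adjacent to `S`. -/
noncomputable def leftStep (G : SimpleGraph (Fin N)) (M : Finset (Sym2 (Fin N)))
    (UL : Finset (Fin N)) (ω : {e : Sym2 (Fin N) // e ∈ M} → Bool) (S : Finset (Fin N)) :
    Finset (Fin N) :=
  Finset.univ.filter fun v =>
    v ∈ leftSide M UL ω ∧ ∃ w, s(v, w) ∈ M ∧ ∃ u ∈ S, G.Adj u w

/-- The left vertices reached from `UL` within `i` rounds of alternating search. -/
noncomputable def reached (G : SimpleGraph (Fin N)) (M : Finset (Sym2 (Fin N)))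
    (UL : Finset (Fin N)) (ω : {e : Sym2 (Fin N) // e ∈ M} → Bool) : ℕ → Finset (Fin N)
  | 0 => UL
  | i + 1 => UL ∪ leftStep G M UL ω (reached G M UL ω i)

theorem mem_leftStep {ω : {e : Sym2 (Fin N) // e ∈ M} → Bool} {S : Finset (Fin N)} {v : Fin N} :
    v ∈ leftStep G M UL ω S ↔
      v ∈ leftSide M UL ω ∧ ∃ w, s(v, w) ∈ M ∧ ∃ u ∈ S, G.Adj u w := by
  simp [leftStep]

theorem UL_subset_reached (ω : {e : Sym2 (Fin N) // e ∈ M} → Bool) (i : ℕ) :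
    UL ⊆ reached G M UL ω i := by
  cases i with
  | zero => exact subset_rfl
  | succ i => exact Finset.subset_union_left

theorem reached_subset_succ (ω : {e : Sym2 (Fin N) // e ∈ M} → Bool) (i : ℕ) :
    reached G M UL ω i ⊆ reached G M UL ω (i + 1) := by
  induction i with
  | zero => exact UL_subset_reached ω 1
  | succ i ih =>
    refine Finset.union_subset_union_right fun v hv => ?_
    obtain ⟨hvL, w, hw, u, hu, huw⟩ := mem_leftStep.1 hv
    exact mem_leftStep.2 ⟨hvL, w, hw, u, ih hu, huw⟩

theorem reached_mono (ω : {e : Sym2 (Fin N) // e ∈ M} → Bool) :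
    Monotone (reached G M UL ω) :=
  monotone_nat_of_le_succ (reached_subset_succ ω)

theorem reached_subset_leftSide (ω : {e : Sym2 (Fin N) // e ∈ M} → Bool) (i : ℕ) :
    (↑(reached G M UL ω i) : Set (Fin N)) ⊆ leftSide M UL ω := by
  intro v hv
  cases i with
  | zero => exact Or.inl hv
  | succ i =>
    rcases Finset.mem_union.1 (Finset.mem_coe.1 hv) with h | h
    · exact Or.inl h
    · exact (mem_leftStep.1 h).1

/-- Reached vertices are ends of alternating paths that end with a matching edge and visit
only reached vertices and their partners. -/
theorem exists_path_of_mem_reached (hM : IsMatchingSet G M) (hUL : ∀ v ∈ UL, Unsaturated M v)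
    (ω : {e : Sym2 (Fin N) // e ∈ M} → Bool) (i : ℕ) {v : Fin N}
    (hv : v ∈ reached G M UL ω i) :
    ∃ u ∈ UL, ∃ p : G.Walk u v, p.IsPath ∧ IsAlternating M p ∧ p.length ≤ 2 * i ∧
      (∀ e ∈ p.edges, CrossesLR (leftSide M UL ω) e) ∧
      (∀ e ∈ p.edges.getLast?, e ∈ M) ∧
      ∀ x ∈ p.support, x ∈ reached G M UL ω i ∨ ∃ y ∈ reached G M UL ω i, s(x, y) ∈ M := by
  induction i generalizing v with
  | zero =>
    refine ⟨v, hv, .nil, by simp, List.IsChain.nil, by simp, by simp, by simp, ?_⟩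
    simpa using Or.inl hv
  | succ i ih =>
    by_cases hvi : v ∈ reached G M UL ω i
    · obtain ⟨u, hu, p, hp, halt, hlen, hcross, hlast, hsupp⟩ := ih hvi
      refine ⟨u, hu, p, hp, halt, by omega, hcross, hlast, fun x hx => ?_⟩
      have hmono := reached_subset_succ (G := G) (UL := UL) ω i
      rcases hsupp x hx with h | ⟨y, hy, hxy⟩
      · exact Or.inl (hmono h)
      · exact Or.inr ⟨y, hmono hy, hxy⟩
    · have hstep : v ∈ leftStep G M UL ω (reached G M UL ω i) := by
        rcases Finset.mem_union.1 hv with h | h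
        · exact absurd (UL_subset_reached ω i h) hvi
        · exact h
      obtain ⟨hvL, w, hvw, z, hz, hzw⟩ := mem_leftStep.1 hstep
      obtain ⟨u, hu, p, hp, halt, hlen, hcross, hlast, hsupp⟩ := ih hz
      have hzL := reached_subset_leftSide (G := G) ω i hz
      have hwL := (mem_leftSide_iff_partner_notMem hM hUL ω hvw).1 hvL
      have hwv : s(w, v) ∈ M := Sym2.eq_swap ▸ hvw
      have hwp : w ∉ p.support := by
        intro hmem
        rcases hsupp w hmem with h | ⟨y, hy, hwy⟩
        · exact hwL (reached_subset_leftSide (G := G) ω i h)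
        · exact hvi (hM.partner_unique hwy hwv ▸ hy)
      have hvp : v ∉ p.support := by
        intro hmem
        rcases hsupp v hmem with h | ⟨y, hy, hvy⟩
        · exact hvi h
        · exact hwL (hM.partner_unique hvy hvw ▸ reached_subset_leftSide (G := G) ω i hy)
      have hadj : G.Adj w v := hM.1 hwv
      have hzwM : s(z, w) ∉ M := by
        intro h
        have h' : s(w, z) ∈ M := Sym2.eq_swap ▸ h
        exact hvi (hM.partner_unique h' hwv ▸ hz)
      have hmono := reached_subset_succ (G := G) (UL := UL) ω i
      refine ⟨u, hu, (p.concat hzw).concat hadj, ?_, ?_, ?_, ?_, ?_, ?_⟩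
      · refine (hp.concat hwp hzw).concat ?_ hadj
        simp [SimpleGraph.Walk.support_concat, hvp, hadj.ne']
      · unfold IsAlternating at halt ⊢
        simp only [SimpleGraph.Walk.edges_concat, List.concat_eq_append]
        refine List.IsChain.append (List.IsChain.append halt (by simp) ?_) (by simp) ?_
        · intro e he f hf
          obtain rfl : s(z, w) = f := by simpa using hf
          exact Or.inl ⟨hlast e he, hzwM⟩
        · intro e he f hf
          obtain rfl : s(w, v) = f := by simpa using hf
          obtain rfl : s(z, w) = e := by simpa using he
          exact Or.inr ⟨hwv, hzwM⟩
      · simp only [SimpleGraph.Walk.length_concat]; omega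
      · intro e he
        simp only [SimpleGraph.Walk.edges_concat, List.concat_eq_append, List.mem_append,
          List.mem_singleton] at he
        rcases he with (he | rfl) | rfl
        · exact hcross e he
        · exact ⟨z, w, rfl, hzL, hwL⟩
        · exact ⟨v, w, Sym2.eq_swap, hvL, hwL⟩
      · simp [SimpleGraph.Walk.edges_concat, hwv]
      · intro x hx
        simp only [SimpleGraph.Walk.support_concat, List.mem_append, List.mem_singleton] at hx
        rcases hx with (hx | rfl) | rfl
        · rcases hsupp x hx with h | ⟨y, hy, hxy⟩
          · exact Or.inl (hmono h)
          · exact Or.inr ⟨y, hmono hy, hxy⟩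
        · exact Or.inr ⟨v, hv, hwv⟩
        · exact Or.inl hv

/-- A reached vertex adjacent to an unsaturated vertex outside `UL` gives a short augmenting
path. -/
theorem exists_augmentingPath_of_adj_reached (hM : IsMatchingSet G M)
    (hUL : ∀ v ∈ UL, Unsaturated M v) (ω : {e : Sym2 (Fin N) // e ∈ M} → Bool) (i : ℕ)
    {z x : Fin N} (hz : z ∈ reached G M UL ω i) (hzx : G.Adj z x) (hx : Unsaturated M x)
    (hxUL : x ∉ UL) :
    ∃ u ∈ UL, ∃ p : G.Walk u x, IsAugmentingPath M p ∧ p.length ≤ 2 * i + 1 := by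
  obtain ⟨u, hu, p, hp, halt, hlen, -, hlast, hsupp⟩ := exists_path_of_mem_reached hM hUL ω i hz
  have hzxM : s(z, x) ∉ M := fun h => hx _ h (Sym2.mem_mk_right z x)
  have hxp : x ∉ p.support := by
    intro hmem
    rcases hsupp x hmem with h | ⟨y, -, hxy⟩
    · rcases exists_partner_of_mem_leftSide (reached_subset_leftSide (G := G) ω i h) with h | ⟨y, hy⟩
      · exact hxUL h
      · exact hx _ hy (Sym2.mem_mk_left x y)
    · exact hx _ hxy (Sym2.mem_mk_left x y)
  refine ⟨u, hu, p.concat hzx, ⟨hp.concat hxp hzx, ?_, hUL u hu, hx⟩, ?_⟩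
  · unfold IsAlternating at halt ⊢
    rw [SimpleGraph.Walk.edges_concat, List.concat_eq_append]
    refine List.IsChain.append halt (by simp) ?_
    intro e he f hf
    obtain rfl : s(z, x) = f := by simpa using hf
    exact Or.inl ⟨hlast e he, hzxM⟩
  · simpa [SimpleGraph.Walk.length_concat] using hlen

/-- Once all matching edges touched by the neighborhood of the reached set are exposed, the
next reached set is determined. -/
theorem reached_succ_congr (hM : IsMatchingSet G M) (hUL : ∀ v ∈ UL, Unsaturated M v)
    {σ ω : {e : Sym2 (Fin N) // e ∈ M} → Bool} {P : Finset {e : Sym2 (Fin N) // e ∈ M}} {i : ℕ}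
    (hω : ∀ e ∈ P, ω e = σ e) (hi : reached G M UL ω i = reached G M UL σ i)
    (hP : ∀ e : {e : Sym2 (Fin N) // e ∈ M}, ∀ w ∈ e.val,
      (∃ u ∈ reached G M UL σ i, G.Adj u w) → e ∈ P) :
    reached G M UL ω (i + 1) = reached G M UL σ (i + 1) := by
  simp only [reached, hi]
  congr 1
  ext v
  simp only [mem_leftStep]
  constructor <;> rintro ⟨hvL, w, hvw, hw⟩ <;> refine ⟨?_, w, hvw, hw⟩
  · exact (mem_leftSide_congr hM hUL (hω ⟨_, hvw⟩ (hP ⟨_, hvw⟩ w (Sym2.mem_mk_right v w) hw))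
      (Sym2.mem_mk_left v w)).1 hvL
  · exact (mem_leftSide_congr hM hUL (hω ⟨_, hvw⟩ (hP ⟨_, hvw⟩ w (Sym2.mem_mk_right v w) hw))
      (Sym2.mem_mk_left v w)).2 hvL

/-- Each neighbor of `S` is either a left vertex of an exposed edge, or the partner of a
vertex in the next layer. -/
theorem card_saturated_neighbors_le (hM : IsMatchingSet G M) (hUL : ∀ v ∈ UL, Unsaturated M v)
    {σ : {e : Sym2 (Fin N) // e ∈ M} → Bool} {P : Finset {e : Sym2 (Fin N) // e ∈ M}}
    {S W : Finset (Fin N)} (hW : ∀ w ∈ W, (∃ v, s(w, v) ∈ M) ∧ ∃ u ∈ S, G.Adj u w)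
    (hP : ∀ e : {e : Sym2 (Fin N) // e ∈ M}, ∀ w ∈ e.val, (∃ u ∈ S, G.Adj u w) → e ∈ P) :
    W.card ≤ P.card + (leftStep G M UL σ S).card := by
  classical
  rw [← Finset.card_filter_add_card_filter_not (s := W) (fun w => w ∈ leftSide M UL σ)]
  refine Nat.add_le_add ?_ ?_
  · refine Finset.card_le_card_of_forall_subsingleton (fun w e => w ∈ e.val) ?_ ?_
    · intro w hw
      obtain ⟨⟨v, hwv⟩, hu⟩ := hW w (Finset.mem_filter.1 hw).1
      exact ⟨⟨_, hwv⟩, hP ⟨_, hwv⟩ w (Sym2.mem_mk_left w v) hu, Sym2.mem_mk_left w v⟩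
    · rintro e - a ⟨ha, hae⟩ b ⟨hb, hbe⟩
      have ha' := (Finset.mem_filter.1 ha).2
      have hb' := (Finset.mem_filter.1 hb).2
      rw [mem_leftSide_iff hM hUL σ e hae] at ha'
      rw [mem_leftSide_iff hM hUL σ e hbe] at hb'
      exact ha'.trans hb'.symm
  · refine Finset.card_le_card_of_forall_subsingleton (fun w v => s(v, w) ∈ M) ?_ ?_
    · intro w hw
      obtain ⟨hwW, hwL⟩ := Finset.mem_filter.1 hw
      obtain ⟨⟨v, hwv⟩, hu⟩ := hW w hwW
      have hvw : s(v, w) ∈ M := Sym2.eq_swap ▸ hwv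
      exact ⟨v, mem_leftStep.2
        ⟨(mem_leftSide_iff_partner_notMem hM hUL σ hvw).2 hwL, w, hvw, hu⟩, hvw⟩
    · rintro v - a ⟨-, ha⟩ b ⟨-, hb⟩
      exact hM.partner_unique ha hb

end Reach

section Exposure

open Classical in
/-- The number of assignments in `F` extending the restriction of `σ` to `P`. -/
noncomputable def extensionCount {I : Type*} [Fintype I] (F : (I → Bool) → Prop)
    (P : Finset I) (σ : I → Bool) : ℕ :=
  (Finset.univ.filter fun ω : I → Bool => F ω ∧ ∀ e ∈ P, ω e = σ e).card

variable {I : Type*} [Fintype I] {F : (I → Bool) → Prop} {P : Finset I}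
  {σ : I → Bool}

theorem extensionCount_eq_zero (h : ∀ ω : I → Bool, (∀ e ∈ P, ω e = σ e) → ¬ F ω) :
    extensionCount F P σ = 0 := by
  classical
  rw [extensionCount, Finset.card_eq_zero, Finset.filter_eq_empty_iff]
  rintro ω - ⟨hF, hω⟩
  exact h ω hω hF

variable [DecidableEq I]

theorem extensionCount_eq_add {e : I} (he : e ∉ P) (c : Bool) :
    extensionCount F P σ = extensionCount F (insert e P) (Function.update σ e c) +
      extensionCount F (insert e P) (Function.update σ e !c) := by
  classical
  have key : ∀ (d : Bool) (ω : I → Bool),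
      (∀ f ∈ insert e P, ω f = Function.update σ e d f) ↔ (∀ f ∈ P, ω f = σ f) ∧ ω e = d := by
    intro d ω
    rw [Finset.forall_mem_insert, Function.update_self, and_comm]
    refine and_congr_left fun _ => forall₂_congr fun f hf => ?_
    rw [Function.update_of_ne (by rintro rfl; exact he hf)]
  unfold extensionCount
  rw [← Finset.card_filter_add_card_filter_not (fun ω : I → Bool => ω e = c)]
  simp only [Finset.filter_filter, key]
  congr 2 <;> ext ω <;> simp [and_assoc]
  cases ω e <;> cases c <;> simp

theorem extensionCount_empty [DecidablePred F] :
    extensionCount F ∅ σ = (Finset.univ.filter F).card := by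
  simp only [extensionCount, Finset.notMem_empty, false_implies, implies_true, and_true]
  congr
  exact Subsingleton.elim _ _

theorem extensionCount_mul_le (F : (I → Bool) → Prop) (P : Finset I) (σ : I → Bool) :
    extensionCount F P σ * 2 ^ P.card ≤ 2 ^ Fintype.card I := by
  classical
  induction h : Pᶜ.card generalizing P σ with
  | zero =>
    have hP : P = Finset.univ := by simpa using h
    have : extensionCount F P σ ≤ 1 := by
      refine Finset.card_le_one.2 fun a ha b hb => ?_
      simp only [hP, Finset.mem_univ, Finset.mem_filter, true_and, true_implies] at ha hb
      funext e
      rw [ha.2, hb.2]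
    rw [hP, Finset.card_univ] at *
    simpa using Nat.mul_le_mul_right (2 ^ Fintype.card I) this
  | succ k ih =>
    obtain ⟨e, he⟩ : Pᶜ.Nonempty := Finset.card_pos.1 (by omega)
    have heP : e ∉ P := Finset.mem_compl.1 he
    have hk : (insert e P)ᶜ.card = k := by
      rw [Finset.compl_insert, Finset.card_erase_of_mem he, h]; rfl
    have h1 := ih (insert e P) (Function.update σ e true) hk
    have h2 := ih (insert e P) (Function.update σ e !true) hk
    rw [Finset.card_insert_of_notMem heP, pow_succ] at h1 h2
    rw [extensionCount_eq_add heP true]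
    nlinarith

/-- One step of the exposure: a fair query moving the potential by `+2` or `-1`. -/
theorem extensionCount_mul_le_of_query {e : I} (he : e ∉ P) (c : Bool) {x : ℤ} {K : ℝ}
    (hK : 0 ≤ K)
    (hgood : (extensionCount F (insert e P) (Function.update σ e c) : ℝ) *
      2 ^ (insert e P).card ≤ (2 / 3 : ℝ) ^ (x + 2 + 1) * K)
    (hbad : (extensionCount F (insert e P) (Function.update σ e !c) : ℝ) *
      2 ^ (insert e P).card ≤ (2 / 3 : ℝ) ^ (x - 1 + 1) * K) :
    (extensionCount F P σ : ℝ) * 2 ^ P.card ≤ (2 / 3 : ℝ) ^ (x + 1) * K := by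
  rw [extensionCount_eq_add he c]
  rw [Finset.card_insert_of_notMem he, pow_succ] at hgood hbad
  have h23 : (2 / 3 : ℝ) ≠ 0 := by norm_num
  have e1 : (2 / 3 : ℝ) ^ (x + 2 + 1) = (2 / 3) ^ x * (8 / 27) := by
    rw [add_assoc, zpow_add₀ h23]; norm_num
  have e2 : (2 / 3 : ℝ) ^ (x + 1) = (2 / 3) ^ x * (2 / 3) := by
    rw [zpow_add₀ h23]; norm_num
  rw [e1] at hgood
  rw [sub_add_cancel] at hbad
  rw [e2]
  push_cast
  have : 0 ≤ (2 / 3 : ℝ) ^ x * K := by positivity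
  nlinarith

end Exposure

/-- Adaptive exposure bound: if the exposed edges split into `g` good and `b` bad ones, where
good edges are witnessed by reached vertices, then the fraction of extensions for which the
search is too small after `t` rounds is at most `(2/3) ^ (4|UL| + 2g - b + 1)`. -/
theorem extensionCount_reached_small_le {N : ℕ} {G : SimpleGraph (Fin N)}
    {M : Finset (Sym2 (Fin N))} {UL : Finset (Fin N)} (hM : IsMatchingSet G M)
    (hUL : ∀ v ∈ UL, Unsaturated M v) {α m : ℝ} (hα : 0 ≤ α) {t : ℕ}
    (hgrow : ∀ σ i, i < t → ((reached G M UL σ i).card : ℝ) ≤ m →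
      ∃ W : Finset (Fin N), α * (reached G M UL σ i).card ≤ W.card ∧
        ∀ w ∈ W, (∃ v, s(w, v) ∈ M) ∧ ∃ u ∈ reached G M UL σ i, G.Adj u w)
    (ht : m < (α / 4) ^ t * UL.card) (k : ℕ) :
    ∀ (i : ℕ) (_ : i + k = t) (P : Finset {e : Sym2 (Fin N) // e ∈ M})
      (σ : {e : Sym2 (Fin N) // e ∈ M} → Bool) (g b : ℕ) (D : Finset (Fin N)),
      (∀ ω : {e : Sym2 (Fin N) // e ∈ M} → Bool, (∀ e ∈ P, ω e = σ e) →
        reached G M UL ω i = reached G M UL σ i) →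
      (α / 4) ^ i * UL.card ≤ (reached G M UL σ i).card →
      D ⊆ leftStep G M UL σ (reached G M UL σ i) →
      (∀ v ∈ D, ∃ e ∈ P, v ∈ e.val) → g ≤ D.card → P.card = g + b →
      (extensionCount (fun ω => ((reached G M UL ω t).card : ℝ) ≤ m) P σ : ℝ) * 2 ^ P.card ≤
        (2 / 3 : ℝ) ^ (4 * UL.card + 2 * g - b + 1 : ℤ) * 2 ^ M.card := by
  classical
  have hzero : ∀ {i : ℕ} (_ : i ≤ t) {P : Finset {e : Sym2 (Fin N) // e ∈ M}}
      {σ : {e : Sym2 (Fin N) // e ∈ M} → Bool},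
      (∀ ω : {e : Sym2 (Fin N) // e ∈ M} → Bool, (∀ e ∈ P, ω e = σ e) →
        reached G M UL ω i = reached G M UL σ i) → m < (reached G M UL σ i).card →
      extensionCount (fun ω => ((reached G M UL ω t).card : ℝ) ≤ m) P σ = 0 := by
    intro i hi P σ hloc hlt
    refine extensionCount_eq_zero fun ω hω hsmall => ?_
    have h := Finset.card_le_card (reached_mono (G := G) (UL := UL) ω hi)
    rw [hloc ω hω] at h
    have h' : ((reached G M UL σ i).card : ℝ) ≤ (reached G M UL ω t).card := by exact_mod_cast h
    linarith
  induction k with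
  | zero =>
    intro i hi P σ g b D hloc hcard _ _ _ _
    obtain rfl : i = t := by omega
    rw [hzero le_rfl hloc (ht.trans_le hcard)]
    simp only [Nat.cast_zero, zero_mul]
    positivity
  | succ k ihk =>
    intro i hi P
    induction hc : Pᶜ.card using Nat.strong_induction_on generalizing P with
    | _ c ihc =>
    intro σ g b D hloc hcard hD hDP hg hPcard
    by_cases hP : ∀ e : {e : Sym2 (Fin N) // e ∈ M}, ∀ w ∈ e.val,
      (∃ u ∈ reached G M UL σ i, G.Adj u w) → e ∈ P
    · rcases lt_or_ge m (reached G M UL σ i).card with hbig | hsmall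
      · rw [hzero (by omega) hloc hbig]
        simp only [Nat.cast_zero, zero_mul]
        positivity
      rcases lt_or_ge (4 * UL.card + 2 * g) b with hx | hx
      · have h1 : (1 : ℝ) ≤ (2 / 3 : ℝ) ^ (4 * UL.card + 2 * g - b + 1 : ℤ) :=
          one_le_zpow_of_nonpos₀ (by norm_num) (by norm_num) (by omega)
        have h2 := extensionCount_mul_le
          (fun ω => ((reached G M UL ω t).card : ℝ) ≤ m) P σ
        rw [Fintype.card_coe] at h2
        calc _ ≤ (2 : ℝ) ^ M.card := by exact_mod_cast h2
          _ ≤ _ := le_mul_of_one_le_left (by positivity) h1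
      · obtain ⟨W, hWcard, hW⟩ := hgrow σ i (by omega) hsmall
        have hWle := card_saturated_neighbors_le hM hUL (σ := σ) hW hP
        have hdisj : Disjoint UL (leftStep G M UL σ (reached G M UL σ i)) := by
          rw [Finset.disjoint_left]
          intro v hv hv'
          obtain ⟨-, w, hw, -⟩ := mem_leftStep.1 hv'
          exact hUL v hv _ hw (Sym2.mem_mk_left v w)
        have hnext : (reached G M UL σ (i + 1)).card =
            UL.card + (leftStep G M UL σ (reached G M UL σ i)).card :=
          Finset.card_union_of_disjoint hdisj
        have hDle := Finset.card_le_card hD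
        have hW4 : (W.card : ℝ) ≤ 4 * (reached G M UL σ (i + 1)).card := by
          exact_mod_cast (by omega : W.card ≤ 4 * (reached G M UL σ (i + 1)).card)
        refine ihk (i + 1) (by omega) P σ g b D
          (fun ω hω => reached_succ_congr hM hUL hω (hloc ω hω) hP) ?_ ?_ hDP hg hPcard
        · rw [pow_succ]
          nlinarith [mul_le_mul_of_nonneg_left hcard hα]
        · refine hD.trans fun v hv => ?_
          obtain ⟨hvL, w, hw, u, hu, huw⟩ := mem_leftStep.1 hv
          exact mem_leftStep.2 ⟨hvL, w, hw, u, reached_subset_succ σ i hu, huw⟩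
    · push Not at hP
      obtain ⟨⟨e, heM⟩, w, hwe, ⟨u, hu, huw⟩, heP⟩ := hP
      obtain ⟨v, rfl⟩ := hwe
      obtain ⟨d, hd⟩ := exists_orientation_notMem_leftSide hM hUL heM
      have hlt : (insert ⟨s(w, v), heM⟩ P)ᶜ.card < c := by
        rw [← hc]
        exact Finset.card_lt_card (Finset.compl_ssubset_compl.2 (Finset.ssubset_insert heP))
      have hagree : ∀ d', ∀ f ∈ P, Function.update σ ⟨s(w, v), heM⟩ d' f = σ f := by
        intro d' f hf
        exact Function.update_of_ne (by rintro rfl; exact heP hf) _ _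
      have hsame : ∀ d', reached G M UL (Function.update σ ⟨s(w, v), heM⟩ d') i =
          reached G M UL σ i := fun d' => hloc _ (hagree d')
      have hloc' : ∀ d', ∀ ω : {e : Sym2 (Fin N) // e ∈ M} → Bool,
          (∀ f ∈ insert ⟨s(w, v), heM⟩ P, ω f = Function.update σ ⟨s(w, v), heM⟩ d' f) →
          reached G M UL ω i = reached G M UL (Function.update σ ⟨s(w, v), heM⟩ d') i := by
        intro d' ω hω
        rw [hsame]
        refine hloc ω fun f hf => ?_
        rw [hω f (Finset.mem_insert_of_mem hf), hagree d' f hf]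
      have hD' : ∀ d', D ⊆ leftStep G M UL (Function.update σ ⟨s(w, v), heM⟩ d')
          (reached G M UL σ i) := by
        intro d' y hy
        obtain ⟨hyL, rest⟩ := mem_leftStep.1 (hD hy)
        obtain ⟨f, hf, hyf⟩ := hDP y hy
        exact mem_leftStep.2
          ⟨(mem_leftSide_congr hM hUL (hagree d' f hf) hyf).2 hyL, rest⟩
      have hDP' : ∀ y ∈ D, ∃ f ∈ insert ⟨s(w, v), heM⟩ P, y ∈ f.val := by
        intro y hy
        obtain ⟨f, hf, hyf⟩ := hDP y hy
        exact ⟨f, Finset.mem_insert_of_mem hf, hyf⟩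
      have hcardP := Finset.card_insert_of_notMem heP
      have hvw : s(v, w) ∈ M := Sym2.eq_swap ▸ heM
      have hvD : v ∉ D := by
        intro hv
        obtain ⟨f, hf, hvf⟩ := hDP v hv
        have : f = ⟨s(w, v), heM⟩ :=
          Subtype.ext (hM.eq_of_mem f.property heM hvf (Sym2.mem_mk_right w v))
        exact heP (this ▸ hf)
      refine extensionCount_mul_le_of_query heP d (by positivity) ?_ ?_
      · have := ihc _ hlt (insert ⟨s(w, v), heM⟩ P) rfl (Function.update σ ⟨s(w, v), heM⟩ d)
          (g + 1) b (insert v D) (hloc' d) (by rwa [hsame]) ?_ ?_ ?_ (by omega)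
        · refine this.trans_eq ?_
          congr 2
          push_cast
          ring
        · rw [hsame]
          refine Finset.insert_subset (mem_leftStep.2 ⟨?_, w, hvw, u, hu, huw⟩) (hD' d)
          exact (mem_leftSide_iff_partner_notMem hM hUL _ hvw).2
            (hd _ (Function.update_self _ _ _))
        · intro y hy
          rcases Finset.mem_insert.1 hy with rfl | hy
          · exact ⟨_, Finset.mem_insert_self _ _, Sym2.mem_mk_right w y⟩
          · exact hDP' y hy
        · rw [Finset.card_insert_of_notMem hvD]; omega
      · have := ihc _ hlt (insert ⟨s(w, v), heM⟩ P) rfl (Function.update σ ⟨s(w, v), heM⟩ !d)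
          g (b + 1) D (hloc' _) (by rwa [hsame]) (by rw [hsame]; exact hD' _) hDP' hg (by omega)
        refine this.trans_eq ?_
        congr 2
        push_cast
        ring

/-- A matching with fewer than `n` edges on `2 * n` vertices leaves a vertex unsaturated. -/
theorem exists_unsaturated {n : ℕ} {M : Finset (Sym2 (Fin (2 * n)))} (h : M.card < n) :
    ∃ v, Unsaturated M v := by
  by_contra hcon
  simp only [Unsaturated, not_exists, not_forall, not_not] at hcon
  have hcover : (Finset.univ : Finset (Fin (2 * n))) ⊆ M.biUnion Sym2.toFinset := by
    intro v _
    obtain ⟨e, he, hv⟩ := hcon v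
    exact Finset.mem_biUnion.2 ⟨e, he, Sym2.mem_toFinset.2 hv⟩
  have h1 := Finset.card_le_card hcover
  have h2 : (M.biUnion Sym2.toFinset).card ≤ M.card * 2 := by
    refine Finset.card_biUnion_le_card_mul _ _ _ fun e _ => ?_
    rw [Sym2.card_toFinset]
    split <;> omega
  rw [Finset.card_univ, Fintype.card_fin] at h1
  omega

/-- Lemma 3.3: let `G` be a graph on `2n` vertices in which every `S` with `|S| ≤ 2εn`
satisfies `|N(S)| ≥ α|S|` (`α ≥ 10`, `0 < ε < 1`, `N(S)` being the vertices outside `S`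
with a neighbor in `S`).  Let `M` be a non-perfect matching, `U_L, U_R` an equal-sized
partition of its unsaturated vertices, and `t = max(⌈log_{α/4}((2εn+1)/|U_L|)⌉, 0)`.
If there is no augmenting path of length at most `4t+1` from `U_L` to `U_R`, then for
strictly more than half of the `2^{|M|}` functions `ω : M → {0,1}` there is a set
`S ⊆ L` with `|S| > 2εn` such that every `v ∈ S` is reachable from `U_L` by an
alternating path of length at most `2t` all of whose edges lie in `E_M(ω)`. -/
theorem short_alternating_paths (n : ℕ) (ε α : ℝ) (hε0 : 0 < ε) (hε1 : ε < 1)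
    (hα : 10 ≤ α)
    (G : SimpleGraph (Fin (2 * n))) [DecidableRel G.Adj]
    (hexpand : ∀ S : Finset (Fin (2 * n)), (S.card : ℝ) ≤ 2 * ε * n →
      α * S.card ≤
        ((Finset.univ.filter (fun v => v ∉ S ∧ ∃ u ∈ S, G.Adj v u)).card : ℝ))
    (M : Finset (Sym2 (Fin (2 * n)))) (hM : IsMatchingSet G M) (hMcard : M.card < n)
    (UL UR : Finset (Fin (2 * n)))
    (hpart : ∀ v : Fin (2 * n), (v ∈ UL ∪ UR ↔ Unsaturated M v))
    (hdisj : Disjoint UL UR) (hsize : UL.card = UR.card)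
    (hno : ¬ ∃ u ∈ UL, ∃ v ∈ UR, ∃ p : G.Walk u v, IsAugmentingPath M p ∧
      (p.length : ℤ) ≤
        4 * max ⌈Real.logb (α / 4) ((2 * ε * n + 1) / (UL.card : ℝ))⌉ 0 + 1) :
    2 ^ M.card <
      2 * Nat.card {ω : {e : Sym2 (Fin (2 * n)) // e ∈ M} → Bool //
        ∃ S : Finset (Fin (2 * n)), (↑S : Set (Fin (2 * n))) ⊆ leftSide M UL ω ∧
          2 * ε * n < (S.card : ℝ) ∧
          ∀ v ∈ S, ∃ u ∈ UL, ∃ p : G.Walk u v, p.IsPath ∧ IsAlternating M p ∧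
            (p.length : ℤ) ≤
              2 * max ⌈Real.logb (α / 4) ((2 * ε * n + 1) / (UL.card : ℝ))⌉ 0 ∧
            ∀ e ∈ p.edges, CrossesLR (leftSide M UL ω) e} := by
  classical
  have hUL : ∀ v ∈ UL, Unsaturated M v := fun v hv => (hpart v).1 (Finset.mem_union_left _ hv)
  have hpos : 0 < UL.card := by
    obtain ⟨v, hv⟩ := exists_unsaturated hMcard
    have h : v ∈ UL ∪ UR := (hpart v).2 hv
    have h' := Finset.card_union_le UL UR
    have := Finset.card_pos.2 ⟨v, h⟩
    omega
  obtain ⟨t, ht⟩ := Int.eq_ofNat_of_zero_le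
    (le_max_right ⌈Real.logb (α / 4) ((2 * ε * n + 1) / (UL.card : ℝ))⌉ 0)
  have hlarge : 2 * ε * n < (α / 4) ^ t * UL.card := by
    have hle : Real.logb (α / 4) ((2 * ε * n + 1) / (UL.card : ℝ)) ≤ (t : ℝ) := by
      have h := Int.ceil_le.1 (le_max_left
        ⌈Real.logb (α / 4) ((2 * ε * n + 1) / (UL.card : ℝ))⌉ 0)
      rw [ht] at h
      exact_mod_cast h
    have hposR : (0 : ℝ) < UL.card := by exact_mod_cast hpos
    rw [Real.logb_le_iff_le_rpow (by linarith) (by positivity), Real.rpow_natCast,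
      div_le_iff₀ hposR] at hle
    linarith
  rw [ht] at hno
  simp only [ht]
  have hgrow : ∀ σ i, i < t → ((reached G M UL σ i).card : ℝ) ≤ 2 * ε * n →
      ∃ W : Finset (Fin (2 * n)), α * (reached G M UL σ i).card ≤ W.card ∧
        ∀ w ∈ W, (∃ v, s(w, v) ∈ M) ∧ ∃ u ∈ reached G M UL σ i, G.Adj u w := by
    intro σ i hi hsmall
    refine ⟨_, hexpand _ hsmall, fun w hw => ?_⟩
    obtain ⟨-, hwS, u, hu, hwu⟩ := Finset.mem_filter.1 hw
    refine ⟨?_, u, hu, hwu.symm⟩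
    by_contra hcon
    have hw' : Unsaturated M w := by
      rintro e he ⟨v, rfl⟩
      exact hcon ⟨v, he⟩
    have hwUL : w ∉ UL := fun h => hwS (UL_subset_reached σ i h)
    obtain ⟨u', hu', p, hp, hlen⟩ :=
      exists_augmentingPath_of_adj_reached hM hUL σ i hu hwu.symm hw' hwUL
    have hwUR : w ∈ UR := (Finset.mem_union.1 ((hpart w).2 hw')).resolve_left hwUL
    exact hno ⟨u', hu', w, hwUR, p, hp, by omega⟩
  have hbound := extensionCount_reached_small_le hM hUL (by linarith) hgrow hlarge t 0
    (by omega) ∅ (fun _ => false) 0 0 ∅ (fun _ _ => rfl) (by simp [reached]) (by simp) (by simp)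
    (by simp) (by simp)
  have hsmall : (2 / 3 : ℝ) ^ (4 * UL.card + 2 * (0 : ℕ) - (0 : ℕ) + 1 : ℤ) < 1 / 2 := by
    calc _ ≤ (2 / 3 : ℝ) ^ (5 : ℤ) :=
          zpow_le_zpow_right_of_le_one₀ (by norm_num) (by norm_num) (by push_cast; omega)
      _ < 1 / 2 := by norm_num
  have hfail : 2 * extensionCount
      (fun ω => ((reached G M UL ω t).card : ℝ) ≤ 2 * ε * n) ∅ (fun _ => false) <
      2 ^ M.card := by
    have h2 : (0 : ℝ) < 2 ^ M.card := by positivity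
    have : (2 : ℝ) * extensionCount
      (fun ω => ((reached G M UL ω t).card : ℝ) ≤ 2 * ε * n) ∅ (fun _ => false) <
      2 ^ M.card := by
      simp only [Finset.card_empty, pow_zero, mul_one] at hbound
      nlinarith
    exact_mod_cast this
  have htotal : (2 : ℕ) ^ M.card = (Finset.univ.filter
      fun ω : {e : Sym2 (Fin (2 * n)) // e ∈ M} → Bool =>
        ((reached G M UL ω t).card : ℝ) ≤ 2 * ε * n).card + (Finset.univ.filter
      fun ω : {e : Sym2 (Fin (2 * n)) // e ∈ M} → Bool =>
        ¬ ((reached G M UL ω t).card : ℝ) ≤ 2 * ε * n).card := by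
    rw [Finset.card_filter_add_card_filter_not]
    simp
  rw [extensionCount_empty] at hfail
  rw [Nat.card_eq_fintype_card, Fintype.card_subtype]
  refine lt_of_lt_of_le (b := 2 * (Finset.univ.filter
      fun ω : {e : Sym2 (Fin (2 * n)) // e ∈ M} → Bool =>
        ¬ ((reached G M UL ω t).card : ℝ) ≤ 2 * ε * n).card) (by omega) ?_
  gcongr 2 * ?_
  refine Finset.card_le_card fun ω hω => ?_
  rw [Finset.mem_filter] at hω ⊢
  refine ⟨hω.1, reached G M UL ω t, reached_subset_leftSide ω t, not_le.1 hω.2, fun v hv => ?_⟩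
  obtain ⟨u, hu, p, hp, halt, hlen, hcross, -, -⟩ := exists_path_of_mem_reached hM hUL ω t hv
  exact ⟨u, hu, p, hp, halt, by omega, hcross⟩
end
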